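/- arXiv:2603.16055 — 5 statements merged into one kernel-verified Lean document; each statement's English description precedes it below -/
import Mathlib

section
/- The function h ↦ V(h) := sup_σ R(σ, h), where the supremum is over all behavior strategies σ in G_h, is lower semi-continuous on the open interval (0,1). -/
open Filter

/-- A POMDP (data only): deterministic signal map `f`, stage payoff `g`,
transition kernel `P`, and initial distribution `p1`. -/
structure POMDP (Ω A S : Type*) where
  f : Ω → S
  g : Ω → A → ℝ
  P : Ω → A → Ω → ℝ
  p1 : Ω → ℝ

/-- A history `(s₁, a₁, …, a_{t-1}, s_t)`, encoded as the reversed list of past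
(signal, action) pairs together with the current signal. -/
abbrev Hist (S A : Type*) := List (S × A) × S

/-- A behavior strategy (data only): a mixed action for every finite history. -/
abbrev Strategy (S A : Type*) := Hist S A → A → ℝ

/-- `σ η ∈ Δ(A)` for every history `η`. -/
def IsStrategy {S A : Type*} [Fintype A] (σ : Strategy S A) : Prop :=
  (∀ η a, 0 ≤ σ η a) ∧ ∀ η, ∑ a, σ η a = 1

namespace POMDP

variable {Ω A S : Type*} [Fintype Ω] [Fintype A]

/-- `P ω a ∈ Δ(Ω)` for every `(ω, a)`, and `p1 ∈ Δ(Ω)`. -/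
def IsValid (M : POMDP Ω A S) : Prop :=
  (∀ ω a ω', 0 ≤ M.P ω a ω') ∧ (∀ ω a, ∑ ω', M.P ω a ω' = 1) ∧
    (∀ ω, 0 ≤ M.p1 ω) ∧ ∑ ω, M.p1 ω = 1

/-- The observable history determined by a reversed past trajectory and the
current state. -/
def obs (M : POMDP Ω A S) (rev : List (Ω × A)) (ω : Ω) : Hist S A :=
  (rev.map fun p => (M.f p.1, p.2), M.f ω)

/-- Probability of a finite trajectory `(ω₁, a₁, …, ω_t, a_t)` under a strategy,
the trajectory being given in reverse order (the head of the list is the most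
recent (state, action) pair). -/
def trajP (M : POMDP Ω A S) (σ : Strategy S A) : List (Ω × A) → ℝ
  | [] => 1
  | (ω, a) :: rest =>
      (match rest with
        | [] => M.p1 ω
        | (ω', a') :: _ => M.P ω' a' ω) *
        σ (M.obs rest ω) a * trajP M σ rest

/-- The expected stage-`(n+1)` payoff `E_σ[g(ω_{n+1}, a_{n+1})]`. -/
noncomputable def stageE (M : POMDP Ω A S) (σ : Strategy S A) (n : ℕ) : ℝ :=
  ∑ tr : Fin (n + 1) → Ω × A, trajP M σ (List.ofFn tr) * M.g (tr 0).1 (tr 0).2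

/-- The expected long-run average payoff
`R(σ) = liminf_T E_σ[(1/T) ∑_{i=1}^T g(ω_i, a_i)]`. -/
noncomputable def R (M : POMDP Ω A S) (σ : Strategy S A) : ℝ :=
  liminf (fun T : ℕ => (1 / (T : ℝ)) * ∑ n ∈ Finset.range T, stageE M σ n) atTop

/-- The POMDP `G_h` with stage duration `h`:
`P_h(⬝|ω,a) = h·P(⬝|ω,a) + (1-h)·δ_ω`. -/
def dur [DecidableEq Ω] (M : POMDP Ω A S) (h : ℝ) : POMDP Ω A S :=
  { M with P := fun ω a ω' => h * M.P ω a ω' + (1 - h) * (if ω' = ω then 1 else 0) }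

/-- The asymptotic value `V(h) = sup_σ R(σ, h)` of `G_h`. -/
noncomputable def V [DecidableEq Ω] (M : POMDP Ω A S) (h : ℝ) : ℝ :=
  sSup {r | ∃ σ : Strategy S A, IsStrategy σ ∧ r = (M.dur h).R σ}

end POMDP

namespace TreeChain

open Topology

/-- Pure strategies, encoded as functions of the list of signals received after the current one. -/
abbrev Tree (Ω A : Type*) := List Ω → A

variable {Ω A : Type*}

/-- The continuation of a pure strategy after the signal `s`. -/
def shift (τ : Tree Ω A) (s : Ω) : Tree Ω A := fun l => τ (s :: l)

/-- The pure strategy that plays `a` and continues with `k s` after the signal `s`. -/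
def node (a : A) (k : Ω → Tree Ω A) : Tree Ω A
  | [] => a
  | s :: l => k s l

@[simp] lemma node_nil (a : A) (k : Ω → Tree Ω A) : node a k [] = a := rfl

@[simp] lemma shift_node (a : A) (k : Ω → Tree Ω A) (s : Ω) : shift (node a k) s = k s := rfl

/-- The successor of a (state, continuation strategy) pair when the next state is `υ`. -/
def next (sg : Ω → Ω) (x : Ω × Tree Ω A) (υ : Ω) : Ω × Tree Ω A := (υ, shift x.2 (sg υ))

/-- The stage payoff as a function of the (state, continuation strategy) pair. -/
def pay (g : Ω → A → ℝ) (x : Ω × Tree Ω A) : ℝ := g x.1 (x.2 [])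

/-- A family of probability distributions on `Ω` indexed by states and actions. -/
def Stoch [Fintype Ω] (P : Ω → A → Ω → ℝ) : Prop :=
  (∀ ω a ω', 0 ≤ P ω a ω') ∧ ∀ ω a, ∑ ω', P ω a ω' = 1

variable [Fintype Ω]

/-- The transition operator of the Markov chain of (state, continuation strategy) pairs. -/
def trans (sg : Ω → Ω) (P : Ω → A → Ω → ℝ) :
    (Ω × Tree Ω A → ℝ) →ₗ[ℝ] (Ω × Tree Ω A → ℝ) where
  toFun φ x := ∑ ω', P x.1 (x.2 []) ω' * φ (next sg x ω')
  map_add' φ ψ := by ext x; simp [mul_add, Finset.sum_add_distrib]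
  map_smul' r φ := by
    ext x; simp only [Pi.smul_apply, smul_eq_mul, RingHom.id_apply, Finset.mul_sum]
    exact Finset.sum_congr rfl fun _ _ => by ring

lemma trans_apply (sg : Ω → Ω) (P : Ω → A → Ω → ℝ) (φ : Ω × Tree Ω A → ℝ) (x : Ω × Tree Ω A) :
    trans sg P φ x = ∑ ω', P x.1 (x.2 []) ω' * φ (next sg x ω') := rfl

/-- The expected total payoff over `T` stages. -/
def tot (sg : Ω → Ω) (g : Ω → A → ℝ) (P : Ω → A → Ω → ℝ) (T : ℕ) : Ω × Tree Ω A → ℝ :=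
  ∑ n ∈ Finset.range T, (trans sg P ^ n) (pay g)

variable {sg : Ω → Ω} {g : Ω → A → ℝ} {P : Ω → A → Ω → ℝ}

@[simp] lemma tot_zero : tot sg g P 0 = 0 := by simp [tot]

lemma tot_succ (T : ℕ) : tot sg g P (T + 1) = pay g + trans sg P (tot sg g P T) := by
  simp only [tot, map_sum, Finset.sum_range_succ', pow_zero, Module.End.one_apply, pow_succ',
    Module.End.mul_apply]
  rw [add_comm]

lemma tot_succ_apply (T : ℕ) (x : Ω × Tree Ω A) : tot sg g P (T + 1) x =
    g x.1 (x.2 []) + ∑ ω', P x.1 (x.2 []) ω' * tot sg g P T (next sg x ω') := by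
  rw [tot_succ]; rfl

lemma Stoch.sum_const_sub (hP : Stoch P) (ω : Ω) (a : A) (v : Ω → ℝ) (c : ℝ) :
    ∑ ω', P ω a ω' * (v ω' + c) = ∑ ω', P ω a ω' * v ω' + c := by
  simp only [mul_add, Finset.sum_add_distrib, ← Finset.sum_mul, hP.2, one_mul]

lemma trans_mono (hP : Stoch P) {φ ψ : Ω × Tree Ω A → ℝ} (h : φ ≤ ψ) :
    trans sg P φ ≤ trans sg P ψ := fun _ =>
  Finset.sum_le_sum fun _ _ => mul_le_mul_of_nonneg_left (h _) (hP.1 _ _ _)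

lemma trans_pow_mono (hP : Stoch P) (n : ℕ) {φ ψ : Ω × Tree Ω A → ℝ} (h : φ ≤ ψ) :
    (trans sg P ^ n) φ ≤ (trans sg P ^ n) ψ := by
  induction n with
  | zero => simpa
  | succ n ih => simpa only [pow_succ', Module.End.mul_apply] using trans_mono hP ih

lemma trans_const (hP : Stoch P) (c : ℝ) :
    trans sg P (fun _ : Ω × Tree Ω A => c) = fun _ => c := by
  ext x; simp [trans_apply, ← Finset.sum_mul, hP.2]

lemma trans_pow_const (hP : Stoch P) (n : ℕ) (c : ℝ) :
    (trans sg P ^ n) (fun _ : Ω × Tree Ω A => c) = fun _ => c := by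
  induction n with
  | zero => rfl
  | succ n ih => rw [pow_succ', Module.End.mul_apply, ih, trans_const hP]

lemma abs_trans_pow_le (hP : Stoch P) (n : ℕ) {φ : Ω × Tree Ω A → ℝ} {C : ℝ}
    (h : ∀ x, |φ x| ≤ C) (x : Ω × Tree Ω A) : |(trans sg P ^ n) φ x| ≤ C := by
  rw [abs_le]
  constructor
  · have := trans_pow_mono (sg := sg) hP n (φ := fun _ => -C) (ψ := φ)
      (fun x => (abs_le.1 (h x)).1) x
    rwa [trans_pow_const hP] at this
  · have := trans_pow_mono (sg := sg) hP n (ψ := fun _ => C) (φ := φ)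
      (fun x => (abs_le.1 (h x)).2) x
    rwa [trans_pow_const hP] at this

lemma abs_tot_le (hP : Stoch P) {G : ℝ} (hg : ∀ ω a, |g ω a| ≤ G) (T : ℕ) (x : Ω × Tree Ω A) :
    |tot sg g P T x| ≤ G * T := by
  rw [tot, Finset.sum_apply]
  refine (Finset.abs_sum_le_sum_abs _ _).trans ?_
  refine (Finset.sum_le_card_nsmul _ _ G fun n _ =>
    abs_trans_pow_le hP n (fun x => hg _ _) x).trans ?_
  simp [mul_comm]

lemma continuousAt_tot {Q : ℝ → Ω → A → Ω → ℝ} {h₀ : ℝ}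
    (hQ : ∀ ω a ω', ContinuousAt (fun h => Q h ω a ω') h₀) (T : ℕ) (x : Ω × Tree Ω A) :
    ContinuousAt (fun h => tot sg g (Q h) T x) h₀ := by
  induction T generalizing x with
  | zero => simpa using continuousAt_const
  | succ T ih =>
    simp only [tot_succ_apply]
    exact continuousAt_const.add (tendsto_finsetSum _ fun ω' _ => (hQ _ _ _).mul (ih _))

/-- `c` is robustly guaranteed near `h₀`: for every `ε` some pure strategy guarantees in the long run
an average payoff of at least `c ω - ε` from every initial state `ω`, for all kernels `Q h` with `h`
close to `h₀`. -/
def Robust (sg : Ω → Ω) (g : Ω → A → ℝ) (Q : ℝ → Ω → A → Ω → ℝ) (h₀ : ℝ) (c : Ω → ℝ) : Prop :=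
  ∀ ε > 0, ∃ τ : Tree Ω A, ∀ᶠ h in 𝓝 h₀, ∀ᶠ T : ℕ in atTop, ∀ ω,
    (c ω - ε) * T ≤ tot sg g (Q h) T (ω, τ)

end TreeChain

namespace TreeChain

open Topology

variable {Ω A : Type*} [Fintype Ω] {sg : Ω → Ω} {g : Ω → A → ℝ} {Q : ℝ → Ω → A → Ω → ℝ} {h₀ : ℝ}

lemma eventually_linear_le {a b : ℝ} (hab : a < b) (C : ℝ) :
    ∀ᶠ T : ℕ in atTop, a * T ≤ b * T - C := by
  filter_upwards [eventually_ge_atTop ⌈C / (b - a)⌉₊] with T hT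
  have h1 : C / (b - a) ≤ T := (Nat.le_ceil _).trans (by exact_mod_cast hT)
  rw [div_le_iff₀ (by linarith)] at h1
  nlinarith

lemma eventually_all_signals {p : Ω → ℝ → ℕ → Prop}
    (hp : ∀ s, ∀ᶠ h in 𝓝 h₀, ∀ᶠ T in atTop, p s h T) :
    ∀ᶠ h in 𝓝 h₀, ∀ᶠ T in atTop, ∀ s, p s h T := by
  filter_upwards [eventually_all.2 hp] with h hh using eventually_all.2 hh

lemma Robust.step (hQ : ∀ ω a ω', ContinuousAt (fun h => Q h ω a ω') h₀)
    (hS : ∀ᶠ h in 𝓝 h₀, Stoch (Q h)) {G : ℝ} (hg : ∀ ω a, |g ω a| ≤ G) (a : A) {c : Ω → Ω → ℝ}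
    (hc : ∀ s, Robust sg g Q h₀ (c s)) :
    Robust sg g Q h₀ fun ω => ∑ ω', Q h₀ ω a ω' * c (sg ω') ω' := by
  intro ε hε
  choose τ hτ using fun s => hc s (ε / 3) (by positivity)
  have hcont : ∀ ω, ∀ᶠ h in 𝓝 h₀, ∑ ω', Q h₀ ω a ω' * c (sg ω') ω' - ε / 3 <
      ∑ ω', Q h ω a ω' * c (sg ω') ω' := fun ω => by
    have : Tendsto (fun h => ∑ ω', Q h ω a ω' * c (sg ω') ω') (𝓝 h₀)
        (𝓝 (∑ ω', Q h₀ ω a ω' * c (sg ω') ω')) :=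
      tendsto_finsetSum _ fun ω' _ => (hQ _ _ _).mul_const _
    exact this.eventually_const_lt (by linarith)
  refine ⟨node a τ, ?_⟩
  filter_upwards [hS, eventually_all_signals hτ, eventually_all.2 hcont] with h hSh hτh hch
  rw [← map_add_atTop_eq_nat 1, eventually_map]
  have hlin := fun ω : Ω => eventually_linear_le
    (a := ∑ ω', Q h₀ ω a ω' * c (sg ω') ω' - ε) (b := ∑ ω', Q h₀ ω a ω' * c (sg ω') ω' - 2 * ε / 3)
    (by linarith) (∑ ω', Q h₀ ω a ω' * c (sg ω') ω' - ε + G)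
  filter_upwards [hτh, eventually_all.2 hlin] with T hT hl ω
  have h1 : ∑ ω', Q h ω a ω' * ((c (sg ω') ω' + -(ε / 3)) * T) ≤
      ∑ ω', Q h ω a ω' * tot sg g (Q h) T (ω', τ (sg ω')) :=
    Finset.sum_le_sum fun ω' _ => mul_le_mul_of_nonneg_left (by
      simpa [sub_eq_add_neg] using hT (sg ω') ω') (hSh.1 _ _ _)
  simp only [← mul_assoc, ← Finset.sum_mul, hSh.sum_const_sub] at h1
  rw [tot_succ_apply]
  simp only [node_nil, next, shift_node]
  have h2 := (abs_le.1 (hg ω a)).1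
  have h3 := hl ω
  have h4 := mul_le_mul_of_nonneg_right (hch ω).le (Nat.cast_nonneg (α := ℝ) T)
  push_cast
  linarith

lemma Robust.trans_pow (hQ : ∀ ω a ω', ContinuousAt (fun h => Q h ω a ω') h₀)
    (hS : ∀ᶠ h in 𝓝 h₀, Stoch (Q h)) {G : ℝ} (hg : ∀ ω a, |g ω a| ≤ G) (n : ℕ)
    {ψ : Ω × Tree Ω A → ℝ} (hψ : ∀ τ, Robust sg g Q h₀ fun ω => ψ (ω, τ)) (τ : Tree Ω A) :
    Robust sg g Q h₀ fun ω => (TreeChain.trans sg (Q h₀) ^ n) ψ (ω, τ) := by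
  induction n generalizing τ with
  | zero => exact hψ τ
  | succ n ih =>
    simp only [pow_succ', Module.End.mul_apply]
    exact Robust.step (c := fun s ω => (TreeChain.trans sg (Q h₀) ^ n) ψ (ω, shift τ s))
      hQ hS hg (τ []) fun s => ih (shift τ s)

lemma robust_initial {p : Ω → ℝ} (hp : ∀ ω, 0 ≤ p ω) (hp1 : ∑ ω, p ω = 1) {c : Ω → Ω → ℝ}
    (hc : ∀ s, Robust sg g Q h₀ (c s)) {ε : ℝ} (hε : 0 < ε) :
    ∃ k : Ω → Tree Ω A, ∀ᶠ h in 𝓝 h₀, ∀ᶠ T : ℕ in atTop,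
      (∑ ω, p ω * c (sg ω) ω - ε) * T ≤ ∑ ω, p ω * tot sg g (Q h) T (ω, k (sg ω)) := by
  choose τ hτ using fun s => hc s ε hε
  refine ⟨τ, ?_⟩
  filter_upwards [eventually_all_signals hτ] with h hh
  filter_upwards [hh] with T hT
  have h1 : ∑ ω, p ω * ((c (sg ω) ω + -ε) * T) ≤ ∑ ω, p ω * tot sg g (Q h) T (ω, τ (sg ω)) :=
    Finset.sum_le_sum fun ω _ => mul_le_mul_of_nonneg_left (hT (sg ω) ω) (hp ω)
  simp only [← mul_assoc, ← Finset.sum_mul, mul_add, Finset.sum_add_distrib, hp1, one_mul] at h1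
  rwa [sub_eq_add_neg]

section Blocks

/-- The memory of a block strategy: a partial labelling of the states by states, the strategy
followed in the current block, and the number of stages left in that block. -/
abbrev Memory (Ω A : Type*) := (Ω → Option Ω) × Tree Ω A × ℕ

open Classical in
/-- The labels of the states reachable from labelled states, when `a` is played and `s` observed. -/
noncomputable def push (sg : Ω → Ω) (P : Ω → A → Ω → ℝ) (ℓ : Ω → Option Ω) (a : A) (s : Ω) :
    Ω → Option Ω := fun ω' =>
  if h : sg ω' = s ∧ ∃ i ω, ℓ ω = some i ∧ P ω a ω' ≠ 0 then some h.2.choose else none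

/-- The memory update: the strategy of the next block is selected by `σ` and its length by `N`. -/
noncomputable def update (sg : Ω → Ω) (P : Ω → A → Ω → ℝ) (σ : (Ω → Option Ω) → Tree Ω A)
    (N : (Ω → Option Ω) → ℕ) (m : Memory Ω A) (s : Ω) : Memory Ω A :=
  let ℓ := push sg P m.1 (m.2.1 []) s
  if m.2.2 ≤ 1 then (ℓ, σ ℓ, N ℓ) else (ℓ, shift m.2.1 s, m.2.2 - 1)

/-- The block strategy started from the memory `m`. -/
noncomputable def blocks (sg : Ω → Ω) (P : Ω → A → Ω → ℝ) (σ : (Ω → Option Ω) → Tree Ω A)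
    (N : (Ω → Option Ω) → ℕ) (m : Memory Ω A) : Tree Ω A :=
  fun l => (l.foldl (update sg P σ N) m).2.1 []

lemma shift_blocks (P : Ω → A → Ω → ℝ) (σ : (Ω → Option Ω) → Tree Ω A)
    (N : (Ω → Option Ω) → ℕ) (m : Memory Ω A) (s : Ω) :
    shift (blocks sg P σ N m) s = blocks sg P σ N (update sg P σ N m s) := rfl

/-- The labels given by `ℓ` are values of `c` at the strategy `σ`, up to the renaming `x`. -/
def Valid (B : Set (Ω × Tree Ω A)) (c : Ω × Tree Ω A → ℝ) (x : Ω → ℝ) (σ : Tree Ω A)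
    (ℓ : Ω → Option Ω) : Prop :=
  ∀ ω i, ℓ ω = some i → (ω, σ) ∈ B ∧ c (ω, σ) = x i

variable {B : Set (Ω × Tree Ω A)} {c : Ω × Tree Ω A → ℝ} {x : Ω → ℝ} {P : Ω → A → Ω → ℝ}

lemma Valid.push
    (hB : ∀ z ∈ B, ∀ ω', P z.1 (z.2 []) ω' ≠ 0 → next sg z ω' ∈ B ∧ c (next sg z ω') = c z)
    {ρ : Tree Ω A} {ℓ : Ω → Option Ω} (h : Valid B c x ρ ℓ) (s : Ω) :
    Valid B c x (shift ρ s) (push sg P ℓ (ρ []) s) := by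
  intro ω' i hi
  unfold TreeChain.push at hi
  split_ifs at hi with hc
  obtain ⟨ω, h1, h2⟩ := hc.2.choose_spec
  rw [Option.some.injEq] at hi
  rw [hi] at h1
  obtain ⟨h3, h4⟩ := h ω i h1
  have := hB _ h3 ω' h2
  rw [h4] at this
  simpa [next, hc.1] using this

lemma Valid.exists_push_eq
    (hB : ∀ z ∈ B, ∀ ω', P z.1 (z.2 []) ω' ≠ 0 → next sg z ω' ∈ B ∧ c (next sg z ω') = c z)
    {ρ : Tree Ω A} {ℓ : Ω → Option Ω} (h : Valid B c x ρ ℓ) {ω ω' i : Ω} (hi : ℓ ω = some i)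
    (hP : P ω (ρ []) ω' ≠ 0) :
    ∃ j, TreeChain.push sg P ℓ (ρ []) (sg ω') ω' = some j ∧ x j = x i := by
  have hc : sg ω' = sg ω' ∧ ∃ i ω, ℓ ω = some i ∧ P ω (ρ []) ω' ≠ 0 := ⟨rfl, i, ω, hi, hP⟩
  have hp : TreeChain.push sg P ℓ (ρ []) (sg ω') ω' = some hc.2.choose := dif_pos hc
  refine ⟨_, hp, ?_⟩
  have h1 := h.push hB (sg ω') ω' _ hp
  have h2 := h ω i hi
  have h3 := hB _ h2.1 ω' hP
  rw [← h1.2, ← h2.2, ← h3.2]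
  rfl

lemma le_tot_blocks
    (hB : ∀ z ∈ B, ∀ ω', P z.1 (z.2 []) ω' ≠ 0 → next sg z ω' ∈ B ∧ c (next sg z ω') = c z)
    {P' : Ω → A → Ω → ℝ} (hP' : Stoch P') (hsupp : ∀ ω a ω', P' ω a ω' ≠ 0 → P ω a ω' ≠ 0)
    {G : ℝ} (hg : ∀ ω a, |g ω a| ≤ G) {y : Ω → ℝ} (hy : ∀ i j, x i = x j → y i = y j)
    {Y : ℝ} (hY : ∀ i, |y i| ≤ Y) {σ : (Ω → Option Ω) → Tree Ω A} {N : (Ω → Option Ω) → ℕ} {L : ℕ}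
    (hN1 : ∀ ℓ, 1 ≤ N ℓ) (hNL : ∀ ℓ, N ℓ ≤ L)
    (hσ : ∀ ℓ ρ, Valid B c x ρ ℓ → Valid B c x (σ ℓ) ℓ ∧
      ∀ ω i, ℓ ω = some i → y i * N ℓ ≤ tot sg g P' (N ℓ) (ω, σ ℓ)) (T : ℕ) :
    ∀ (ℓ : Ω → Option Ω) (ρ : Tree Ω A) (n : ℕ), Valid B c x ρ ℓ → 1 ≤ n → n ≤ L →
      ∀ ω i, ℓ ω = some i →
        tot sg g P' n (ω, ρ) + y i * (T - n) - (G + Y) * L ≤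
          tot sg g P' T (ω, blocks sg P σ N (ℓ, ρ, n)) := by
  induction T with
  | zero =>
    intro ℓ ρ n _ _ hnL ω i _
    have h1 := (abs_le.1 (abs_tot_le (sg := sg) hP' hg n (ω, ρ))).2
    have h2 := (abs_le.1 (hY i)).1
    have h3 : (0 : ℝ) ≤ G := (abs_nonneg _).trans (hg ω (ρ []))
    have h4 : (0 : ℝ) ≤ Y := (abs_nonneg _).trans (hY i)
    have h5 : (n : ℝ) ≤ L := by exact_mod_cast hnL
    have h6 : (0 : ℝ) ≤ n := n.cast_nonneg
    simp only [tot_zero, Pi.zero_apply, Nat.cast_zero, zero_sub]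
    nlinarith
  | succ T ih =>
    intro ℓ ρ n hv hn hnL ω i hi
    obtain ⟨k, rfl⟩ : ∃ k, n = k + 1 := ⟨n - 1, by omega⟩
    have key : ∀ ω', P' ω (ρ []) ω' *
        (tot sg g P' k (next sg (ω, ρ) ω') + (y i * (T - k) - (G + Y) * L)) ≤ P' ω (ρ []) ω' *
        tot sg g P' T (next sg (ω, blocks sg P σ N (ℓ, ρ, k + 1)) ω') := fun ω' => by
      by_cases h0 : P' ω (ρ []) ω' = 0
      · simp [h0]
      refine mul_le_mul_of_nonneg_left ?_ (hP'.1 _ _ _)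
      obtain ⟨j, hj, hxj⟩ := hv.exists_push_eq (sg := sg) hB hi (hsupp _ _ _ h0)
      have hv' := hv.push (sg := sg) hB (sg ω')
      simp only [next, shift_blocks]
      rw [← hy j i hxj]
      unfold update
      rcases Nat.eq_zero_or_pos k with rfl | hk
      · simp only [zero_add, le_refl, if_true]
        obtain ⟨hvσ, hp⟩ := hσ _ _ hv'
        have h1 := ih _ _ (N _) hvσ (hN1 (push sg P ℓ (ρ []) (sg ω'))) (hNL _) ω' j hj
        have h2 := hp ω' j hj
        simp only [tot_zero, Pi.zero_apply, Nat.cast_zero]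
        linarith
      · rw [if_neg (by simp; omega)]
        simp only [Nat.add_sub_cancel]
        have h1 := ih _ _ k hv' hk (by omega) ω' j hj
        linarith
    have h1 := Finset.sum_le_sum fun ω' (_ : ω' ∈ Finset.univ) => key ω'
    rw [hP'.sum_const_sub] at h1
    rw [tot_succ_apply, tot_succ_apply]
    push_cast
    change _ ≤ g ω (ρ []) + ∑ ω', P' ω (ρ []) ω' * _
    linarith

open Classical in
/-- If `c` is constant along the chain on the absorbing set `B`, and it is approximated from below
by finite-horizon averages on `B`, then the values of `c` on `B` are robustly guaranteed. -/
theorem robust_of_absorbing (hQ : ∀ ω a ω', ContinuousAt (fun h => Q h ω a ω') h₀)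
    (hS : ∀ᶠ h in 𝓝 h₀, Stoch (Q h))
    (hsupp : ∀ᶠ h in 𝓝 h₀, ∀ ω a ω', Q h ω a ω' ≠ 0 → Q h₀ ω a ω' ≠ 0)
    {G : ℝ} (hg : ∀ ω a, |g ω a| ≤ G)
    (hB : ∀ z ∈ B, ∀ ω', Q h₀ z.1 (z.2 []) ω' ≠ 0 → next sg z ω' ∈ B ∧ c (next sg z ω') = c z)
    (havg : ∀ σ, ∀ ε > 0, ∃ N : ℕ, 1 ≤ N ∧ ∀ ω, (ω, σ) ∈ B →
      (c (ω, σ) - ε) * N ≤ tot sg g (Q h₀) N (ω, σ))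
    (τ : Tree Ω A) :
    Robust sg g Q h₀ fun ω => if (ω, τ) ∈ B then c (ω, τ) else -G := by
  intro ε hε
  set x : Ω → ℝ := fun ω => c (ω, τ) with hx
  have hch : ∀ ℓ : Ω → Option Ω, ∃ (σ : Tree Ω A) (N : ℕ), 1 ≤ N ∧ ∀ ρ, Valid B c x ρ ℓ →
      Valid B c x σ ℓ ∧ ∀ ω i, ℓ ω = some i → (x i - ε / 4) * N ≤ tot sg g (Q h₀) N (ω, σ) := by
    intro ℓ
    by_cases h : ∃ ρ, Valid B c x ρ ℓ
    · obtain ⟨σ, hσ⟩ := h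
      obtain ⟨N, hN, hN'⟩ := havg σ (ε / 4) (by positivity)
      refine ⟨σ, N, hN, fun _ _ => ⟨hσ, fun ω i hi => ?_⟩⟩
      obtain ⟨h1, h2⟩ := hσ ω i hi
      rw [← h2]
      exact hN' ω h1
    · exact ⟨τ, 1, le_rfl, fun ρ hρ => (h ⟨ρ, hρ⟩).elim⟩
  choose σ N hN hσ using hch
  obtain ⟨L, hL⟩ : ∃ L, ∀ ℓ, N ℓ ≤ L :=
    ⟨∑ ℓ, N ℓ, fun ℓ => Finset.single_le_sum (fun _ _ => Nat.zero_le _) (Finset.mem_univ ℓ)⟩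
  set y : Ω → ℝ := fun i => x i - ε / 2 with hydef
  obtain ⟨Y, hY⟩ : ∃ Y, ∀ i, |y i| ≤ Y :=
    ⟨∑ i, |y i|, fun i =>
      Finset.single_le_sum (f := fun i => |y i|) (fun _ _ => abs_nonneg _) (Finset.mem_univ i)⟩
  have hcont : ∀ (ℓ : Ω → Option Ω) (ω : Ω), ∀ᶠ h in 𝓝 h₀,
      tot sg g (Q h₀) (N ℓ) (ω, σ ℓ) - ε / 4 * N ℓ < tot sg g (Q h) (N ℓ) (ω, σ ℓ) := fun ℓ ω => by
    refine (continuousAt_tot hQ (N ℓ) (ω, σ ℓ)).eventually_const_lt ?_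
    have : (0 : ℝ) < N ℓ := by exact_mod_cast hN ℓ
    simp only [sub_lt_self_iff]
    positivity
  set ℓ₀ : Ω → Option Ω := fun ω => if (ω, τ) ∈ B then some ω else none with hℓ₀
  have hv₀ : Valid B c x τ ℓ₀ := by
    intro ω i hi
    by_cases h : (ω, τ) ∈ B <;> simp [hℓ₀, h] at hi
    subst hi
    exact ⟨h, rfl⟩
  refine ⟨blocks sg (Q h₀) σ N (ℓ₀, σ ℓ₀, N ℓ₀), ?_⟩
  filter_upwards [hS, hsupp, eventually_all.2 fun ℓ => eventually_all.2 (hcont ℓ)]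
    with h hSh hsupph hch
  have hσ' : ∀ ℓ ρ, Valid B c x ρ ℓ → Valid B c x (σ ℓ) ℓ ∧
      ∀ ω i, ℓ ω = some i → y i * N ℓ ≤ tot sg g (Q h) (N ℓ) (ω, σ ℓ) := fun ℓ ρ hρ => by
    refine ⟨(hσ ℓ ρ hρ).1, fun ω i hi => ?_⟩
    have h1 := (hσ ℓ ρ hρ).2 ω i hi
    have h2 := hch ℓ ω
    simp only [hydef]
    linarith
  refine eventually_all.2 fun ω => ?_
  by_cases hω : (ω, τ) ∈ B
  · filter_upwards [eventually_linear_le (a := x ω - ε) (b := y ω) (by simp [hydef]; linarith)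
      ((G + Y) * L)] with T hT
    have h1 := le_tot_blocks (sg := sg) (y := y) hB hSh hsupph hg
      (fun i j hij => by simp [hydef, hij]) hY hN hL hσ' T ℓ₀ (σ ℓ₀) (N ℓ₀) (hσ' _ _ hv₀).1 (hN _)
      (hL _) ω ω (by simp [hℓ₀, hω])
    have h2 := (hσ' _ _ hv₀).2 ω ω (by simp [hℓ₀, hω])
    rw [if_pos hω]
    change (x ω - ε) * T ≤ _
    linarith
  · refine Eventually.of_forall fun T => ?_
    rw [if_neg hω]
    have h1 := (abs_le.1 (abs_tot_le (sg := sg) hSh hg T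
      (ω, blocks sg (Q h₀) σ N (ℓ₀, σ ℓ₀, N ℓ₀)))).1
    have : (0 : ℝ) ≤ ε * T := by positivity
    linarith

end Blocks

end TreeChain

namespace TreeChain

open Topology MeasureTheory

set_option linter.unusedSectionVars false

variable {Ω A : Type*} [Fintype Ω] {sg : Ω → Ω} {g : Ω → A → ℝ} {P : Ω → A → Ω → ℝ}

section Continuity

variable [TopologicalSpace Ω] [DiscreteTopology Ω] [TopologicalSpace A] [DiscreteTopology A]

lemma continuous_next (ω' : Ω) : Continuous fun x : Ω × Tree Ω A => next sg x ω' := by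
  refine continuous_const.prodMk (continuous_pi fun l => ?_)
  exact (continuous_apply (sg ω' :: l)).comp continuous_snd

lemma continuous_of_stage {β : Type*} [TopologicalSpace β] (v : Ω → A → β) :
    Continuous fun x : Ω × Tree Ω A => v x.1 (x.2 []) := by
  have h : Continuous fun x : Ω × Tree Ω A => (x.1, x.2 []) :=
    continuous_fst.prodMk ((continuous_apply []).comp continuous_snd)
  exact (continuous_of_discreteTopology (f := fun z : Ω × A => v z.1 z.2)).comp h

lemma continuous_pay : Continuous (pay (Ω := Ω) g) := continuous_of_stage g

lemma continuous_trans {φ : Ω × Tree Ω A → ℝ} (hφ : Continuous φ) :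
    Continuous (trans sg P φ) :=
  continuous_finsetSum _ fun ω' _ =>
    (continuous_of_stage fun ω a => P ω a ω').mul (hφ.comp (continuous_next ω'))

lemma continuous_trans_pow {φ : Ω × Tree Ω A → ℝ} (hφ : Continuous φ) (n : ℕ) :
    Continuous ((trans sg P ^ n) φ) := by
  induction n with
  | zero => simpa
  | succ n ih =>
    rw [pow_succ', Module.End.mul_apply]
    exact continuous_trans ih

lemma continuous_tot (T : ℕ) : Continuous (tot sg g P T) := by
  have h : tot sg g P T = fun x => ∑ n ∈ Finset.range T, (trans sg P ^ n) (pay g) x := by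
    ext x; simp [tot]
  rw [h]
  exact continuous_finsetSum _ fun n _ => continuous_trans_pow continuous_pay n

/-- The transition operator on continuous functions. -/
def transC (sg : Ω → Ω) (P : Ω → A → Ω → ℝ) :
    C(Ω × Tree Ω A, ℝ) →ₗ[ℝ] C(Ω × Tree Ω A, ℝ) where
  toFun φ := ⟨trans sg P φ, continuous_trans φ.continuous⟩
  map_add' φ ψ := by ext x; simp
  map_smul' r φ := by ext x; simp

@[simp] lemma coe_transC (φ : C(Ω × Tree Ω A, ℝ)) : ⇑(transC sg P φ) = trans sg P φ := rfl

lemma coe_transC_pow (φ : C(Ω × Tree Ω A, ℝ)) (n : ℕ) :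
    ⇑((transC sg P ^ n) φ) = (trans sg P ^ n) φ := by
  induction n with
  | zero => rfl
  | succ n ih => rw [pow_succ', pow_succ', Module.End.mul_apply, coe_transC, ih]; rfl

end Continuity

section Invariant

variable [TopologicalSpace Ω] [DiscreteTopology Ω] [MeasurableSpace Ω] [BorelSpace Ω]
  [Finite A] [TopologicalSpace A] [DiscreteTopology A] [MeasurableSpace A] [BorelSpace A]

/-- Invariance of a measure under the Markov chain with transition operator `trans sg P`. -/
def Invariant (sg : Ω → Ω) (P : Ω → A → Ω → ℝ) (ν : Measure (Ω × Tree Ω A)) : Prop :=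
  ∀ φ : Ω × Tree Ω A → ℝ, Continuous φ → ∫ x, trans sg P φ x ∂ν = ∫ x, φ x ∂ν

variable {ν : Measure (Ω × Tree Ω A)} [IsProbabilityMeasure ν]

lemma integrable_of_continuous {φ : Ω × Tree Ω A → ℝ} (hφ : Continuous φ) : Integrable φ ν :=
  (BoundedContinuousFunction.mkOfCompact ⟨φ, hφ⟩).integrable ν

lemma Invariant.eq_sum (hP : Stoch P) (hν : Invariant sg P ν) :
    Measure.sum (fun ω' : Ω => (ν.withDensity fun x =>
      ENNReal.ofReal (P x.1 (x.2 []) ω')).map (next sg · ω')) = ν := by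
  have hm : ∀ ω' : Ω, Measurable fun x : Ω × Tree Ω A => (P x.1 (x.2 []) ω').toNNReal :=
    fun ω' => (continuous_of_stage fun ω a => (P ω a ω').toNNReal).measurable
  have hfin : ∀ ω' : Ω, IsFiniteMeasure ((ν.withDensity fun x =>
      ENNReal.ofReal (P x.1 (x.2 []) ω')).map (next sg · ω')) := fun ω' => by
    have : IsFiniteMeasure (ν.withDensity fun x => ENNReal.ofReal (P x.1 (x.2 []) ω')) :=
      isFiniteMeasure_withDensity_ofReal
        (integrable_of_continuous (continuous_of_stage fun ω a => P ω a ω')).2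
    infer_instance
  rw [Measure.sum_fintype]
  have : IsFiniteMeasure (∑ ω' : Ω, (ν.withDensity fun x =>
      ENNReal.ofReal (P x.1 (x.2 []) ω')).map (next sg · ω')) := inferInstance
  refine ext_of_forall_integral_eq_of_IsFiniteMeasure fun φ => ?_
  rw [integral_finsetSum_measure fun ω' _ => φ.integrable _, ← hν φ φ.continuous]
  have hi : ∀ ω' ∈ Finset.univ, Integrable (fun x : Ω × Tree Ω A =>
      P x.1 (x.2 []) ω' * φ (next sg x ω')) ν := fun ω' _ => integrable_of_continuous
    ((continuous_of_stage fun ω a => P ω a ω').mul (φ.continuous.comp (continuous_next ω')))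
  simp only [trans_apply]
  rw [integral_finsetSum _ hi]
  refine Finset.sum_congr rfl fun ω' _ => ?_
  rw [integral_map (continuous_next ω').measurable.aemeasurable
    φ.continuous.aestronglyMeasurable]
  have := integral_withDensity_eq_integral_smul (μ := ν) (hm ω') fun x => φ (next sg x ω')
  simp only [ENNReal.ofReal]
  rw [this]
  refine integral_congr_ae (Eventually.of_forall fun x => ?_)
  simp [NNReal.smul_def, hP.1]

lemma Invariant.ae_next (hP : Stoch P) (hν : Invariant sg P ν) {p : Ω × Tree Ω A → Prop}
    (hp : ∀ᵐ x ∂ν, p x) : ∀ᵐ x ∂ν, ∀ ω', P x.1 (x.2 []) ω' ≠ 0 → p (next sg x ω') := by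
  refine ae_all_iff.2 fun ω' => ?_
  rw [← hν.eq_sum hP, Measure.ae_sum_iff] at hp
  have h1 := ae_of_ae_map (continuous_next ω').measurable.aemeasurable (hp ω')
  rw [ae_withDensity_iff] at h1
  · filter_upwards [h1] with x hx h0
    exact hx (by simpa using (hP.1 _ _ _).lt_of_ne' h0)
  · exact (continuous_of_stage fun ω a => ENNReal.ofReal (P ω a ω')).measurable

end Invariant

end TreeChain

namespace TreeChain

open Topology MeasureTheory

set_option linter.unusedSectionVars false

section Ergodic

variable {Ω A : Type*} [Fintype Ω] {sg : Ω → Ω} {g : Ω → A → ℝ} {P : Ω → A → Ω → ℝ}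

/-- The mean squared variation of `φ` along a transition. -/
def disp (sg : Ω → Ω) (P : Ω → A → Ω → ℝ) (φ : Ω × Tree Ω A → ℝ) (x : Ω × Tree Ω A) : ℝ :=
  ∑ ω', P x.1 (x.2 []) ω' * (φ (next sg x ω') - φ x) ^ 2

lemma disp_nonneg (hP : Stoch P) (φ : Ω × Tree Ω A → ℝ) (x : Ω × Tree Ω A) :
    0 ≤ disp sg P φ x :=
  Finset.sum_nonneg fun _ _ => mul_nonneg (hP.1 _ _ _) (sq_nonneg _)

lemma sum_mul_sub_sq (hP : Stoch P) (φ : Ω × Tree Ω A → ℝ) (x : Ω × Tree Ω A) (m : ℝ) :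
    ∑ ω', P x.1 (x.2 []) ω' * (φ (next sg x ω') - m) ^ 2 =
      trans sg P (fun y => φ y ^ 2) x - 2 * m * trans sg P φ x + m ^ 2 := by
  have h : ∀ ω', P x.1 (x.2 []) ω' * (φ (next sg x ω') - m) ^ 2 =
      P x.1 (x.2 []) ω' * φ (next sg x ω') ^ 2 - 2 * m * (P x.1 (x.2 []) ω' * φ (next sg x ω'))
        + P x.1 (x.2 []) ω' * m ^ 2 := fun ω' => by ring
  simp only [h, Finset.sum_add_distrib, Finset.sum_sub_distrib, ← Finset.mul_sum, ← Finset.sum_mul,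
    hP.2, one_mul, trans_apply]

lemma sq_trans_le (hP : Stoch P) (φ : Ω × Tree Ω A → ℝ) (x : Ω × Tree Ω A) :
    trans sg P φ x ^ 2 ≤ trans sg P (fun y => φ y ^ 2) x := by
  have h := sum_mul_sub_sq (sg := sg) hP φ x (trans sg P φ x)
  have h0 : 0 ≤ ∑ ω', P x.1 (x.2 []) ω' * (φ (next sg x ω') - trans sg P φ x) ^ 2 :=
    Finset.sum_nonneg fun ω' _ => mul_nonneg (hP.1 _ _ _) (sq_nonneg _)
  nlinarith

/-- The expected average payoff over `N` stages. -/
noncomputable def avg (sg : Ω → Ω) (g : Ω → A → ℝ) (P : Ω → A → Ω → ℝ) (N : ℕ) :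
    Ω × Tree Ω A → ℝ :=
  (N : ℝ)⁻¹ • tot sg g P N

lemma abs_avg_le (hP : Stoch P) {G : ℝ} (hG : 0 ≤ G) (hg : ∀ ω a, |g ω a| ≤ G) (N : ℕ)
    (x : Ω × Tree Ω A) : |avg sg g P N x| ≤ G := by
  rw [avg, Pi.smul_apply, smul_eq_mul, abs_mul, abs_inv, Nat.abs_cast, inv_mul_eq_div]
  exact div_le_of_le_mul₀ N.cast_nonneg hG (abs_tot_le hP hg N x)

lemma avg_sub_trans_avg (N : ℕ) (x : Ω × Tree Ω A) :
    avg sg g P N x - trans sg P (avg sg g P N) x =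
      (N : ℝ)⁻¹ * (pay g x - (trans sg P ^ N) (pay g) x) := by
  have h1 := congrFun (tot_succ (sg := sg) (g := g) (P := P) N) x
  have h2 : tot sg g P (N + 1) x = tot sg g P N x + (trans sg P ^ N) (pay g) x := by
    rw [tot, Finset.sum_range_succ]; rfl
  simp only [avg, map_smul, Pi.smul_apply, smul_eq_mul, Pi.add_apply] at h1 ⊢
  rw [← mul_sub]
  congr 1
  linarith

variable [TopologicalSpace Ω] [DiscreteTopology Ω] [TopologicalSpace A] [DiscreteTopology A]

lemma continuous_avg (N : ℕ) : Continuous (avg sg g P N) := (continuous_tot N).const_smul _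

lemma continuous_disp {φ : Ω × Tree Ω A → ℝ} (hφ : Continuous φ) : Continuous (disp sg P φ) :=
  continuous_finsetSum _ fun ω' _ => (continuous_of_stage fun ω a => P ω a ω').mul
    (((hφ.comp (continuous_next ω')).sub hφ).pow 2)

variable [MeasurableSpace Ω] [BorelSpace Ω] [Finite A] [MeasurableSpace A] [BorelSpace A]
variable {ν : Measure (Ω × Tree Ω A)} [IsProbabilityMeasure ν]

lemma Invariant.integral_disp (hP : Stoch P) (hν : Invariant sg P ν) {φ : Ω × Tree Ω A → ℝ}
    (hφ : Continuous φ) :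
    ∫ x, disp sg P φ x ∂ν = 2 * ∫ x, φ x * (φ x - trans sg P φ x) ∂ν := by
  simp only [disp, sum_mul_sub_sq hP]
  have h1 : ∀ x, trans sg P (fun y => φ y ^ 2) x - 2 * φ x * trans sg P φ x + φ x ^ 2 =
    (trans sg P (fun y => φ y ^ 2) x - φ x ^ 2) + 2 * (φ x * (φ x - trans sg P φ x)) :=
    fun x => by ring
  simp only [h1]
  have c2 : Continuous fun y => φ y ^ 2 := hφ.pow 2
  have c1 := continuous_trans (sg := sg) (P := P) c2
  rw [integral_add, integral_sub, hν _ c2, sub_self, zero_add, integral_const_mul]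
  · exact integrable_of_continuous c1
  · exact integrable_of_continuous c2
  · exact integrable_of_continuous (c1.sub c2)
  · exact integrable_of_continuous
      (continuous_const.mul (hφ.mul (hφ.sub (continuous_trans hφ))))

lemma Invariant.integral_disp_avg_le (hP : Stoch P) (hν : Invariant sg P ν) {G : ℝ} (hG : 0 ≤ G)
    (hg : ∀ ω a, |g ω a| ≤ G) (N : ℕ) :
    ∫ x, disp sg P (avg sg g P N) x ∂ν ≤ 4 * G ^ 2 * (N : ℝ)⁻¹ := by
  rw [hν.integral_disp hP (continuous_avg N)]
  have : ∫ x, avg sg g P N x * (avg sg g P N x - trans sg P (avg sg g P N) x) ∂ν ≤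
      ∫ _, 2 * G ^ 2 * (N : ℝ)⁻¹ ∂ν := by
    refine integral_mono (integrable_of_continuous ((continuous_avg N).mul
      ((continuous_avg N).sub (continuous_trans (continuous_avg N))))) (integrable_const _)
      fun x => ?_
    dsimp only
    rw [avg_sub_trans_avg]
    have h1 := abs_avg_le (sg := sg) hP hG hg N x
    have h2 : |pay g x - (trans sg P ^ N) (pay g) x| ≤ 2 * G := by
      have h3 := abs_trans_pow_le (sg := sg) (φ := pay g) hP N (fun x => hg _ _) x
      have h4 : |pay g x| ≤ G := hg _ _
      exact (abs_sub _ _).trans (by linarith)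
    refine (le_abs_self _).trans ?_
    rw [abs_mul, abs_mul, abs_inv, Nat.abs_cast]
    have h5 : |avg sg g P N x| * |pay g x - (trans sg P ^ N) (pay g) x| ≤ G * (2 * G) :=
      mul_le_mul h1 h2 (abs_nonneg _) hG
    have h6 : (0 : ℝ) ≤ (N : ℝ)⁻¹ := by positivity
    nlinarith
  rw [integral_const] at this
  simp only [probReal_univ, one_smul] at this
  linarith

lemma Invariant.norm_toLp_transC_le (hP : Stoch P) (hν : Invariant sg P ν)
    (φ : C(Ω × Tree Ω A, ℝ)) :
    ‖ContinuousMap.toLp 2 ν ℝ (transC sg P φ)‖ ≤ ‖ContinuousMap.toLp 2 ν ℝ φ‖ := by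
  rw [← sq_le_sq₀ (norm_nonneg _) (norm_nonneg _), ← real_inner_self_eq_norm_sq,
    ← real_inner_self_eq_norm_sq, ContinuousMap.inner_toLp, ContinuousMap.inner_toLp]
  simp only [conj_trivial, ← sq, coe_transC]
  have c2 : Continuous fun y => φ y ^ 2 := φ.continuous.pow 2
  rw [← hν _ c2]
  exact integral_mono (integrable_of_continuous ((continuous_trans φ.continuous).pow 2))
    (integrable_of_continuous (continuous_trans c2)) fun x => sq_trans_le hP _ x

/-- Mean ergodic theorem: the average payoffs converge in measure. -/
lemma Invariant.tendstoInMeasure_avg (hP : Stoch P) (hν : Invariant sg P ν) (g : Ω → A → ℝ) :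
    ∃ c : Ω × Tree Ω A → ℝ, TendstoInMeasure ν (avg sg g P) atTop c := by
  set e : C(Ω × Tree Ω A, ℝ) →L[ℝ] Lp ℝ 2 ν := ContinuousMap.toLp 2 ν ℝ with he
  have hd : DenseRange (e : C(Ω × Tree Ω A, ℝ) →ₗ[ℝ] Lp ℝ 2 ν) :=
    ContinuousMap.toLp_denseRange ℝ ν ℝ (by simp)
  have hb : ∀ φ, ‖((e : C(Ω × Tree Ω A, ℝ) →ₗ[ℝ] Lp ℝ 2 ν) ∘ₗ transC sg P) φ‖ ≤
      1 * ‖(e : C(Ω × Tree Ω A, ℝ) →ₗ[ℝ] Lp ℝ 2 ν) φ‖ := fun φ => by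
    rw [one_mul]; exact hν.norm_toLp_transC_le hP φ
  set U := ((e : C(Ω × Tree Ω A, ℝ) →ₗ[ℝ] Lp ℝ 2 ν) ∘ₗ transC sg P).extendOfNorm
    (e : C(Ω × Tree Ω A, ℝ) →ₗ[ℝ] Lp ℝ 2 ν) with hU
  have hUe : ∀ φ, U (e φ) = e (transC sg P φ) := LinearMap.extendOfNorm_eq hd ⟨1, hb⟩
  have hU1 : ‖U‖ ≤ 1 := LinearMap.opNorm_extendOfNorm_le hd zero_le_one hb
  have hUn : ∀ n φ, U^[n] (e φ) = e ((transC sg P ^ n) φ) := fun n φ => by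
    induction n with
    | zero => rfl
    | succ n ih => rw [Function.iterate_succ_apply', ih, hUe, pow_succ', Module.End.mul_apply]
  set p : C(Ω × Tree Ω A, ℝ) := ⟨pay g, continuous_pay⟩ with hp
  have ht := ContinuousLinearMap.tendsto_birkhoffAverage_orthogonalProjection U hU1 (e p)
  have havg : ∀ N, birkhoffAverage ℝ U id N (e p) =
      e ⟨avg sg g P N, continuous_avg N⟩ := fun N => by
    simp only [birkhoffAverage, birkhoffSum, id, hUn]
    rw [← map_sum, ← map_smul]
    congr 1
    ext x
    simp [avg, tot, coe_transC_pow, hp]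
  simp only [havg] at ht
  refine ⟨_, (tendstoInMeasure_of_tendsto_Lp ht).congr (fun N => ?_) EventuallyEq.rfl⟩
  exact ContinuousMap.coeFn_toLp ν _

lemma Invariant.tendstoInMeasure_disp (hP : Stoch P) (hν : Invariant sg P ν) (g : Ω → A → ℝ) :
    TendstoInMeasure ν (fun N => disp sg P (avg sg g P N)) atTop 0 := by
  obtain ⟨G, hG, hg⟩ : ∃ G : ℝ, 0 ≤ G ∧ ∀ ω a, |g ω a| ≤ G := by
    obtain ⟨G, hG⟩ := Finite.bddAbove_range fun z : Ω × A => |g z.1 z.2|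
    exact ⟨max G 0, le_max_right _ _, fun ω a => (hG ⟨(ω, a), rfl⟩).trans (le_max_left _ _)⟩
  refine tendstoInMeasure_of_tendsto_eLpNorm one_ne_zero
    (fun N => (continuous_disp (continuous_avg N)).aestronglyMeasurable)
    aestronglyMeasurable_const ?_
  have h1 : ∀ N, eLpNorm (disp sg P (avg sg g P N) - 0) 1 ν =
      ENNReal.ofReal (∫ x, disp sg P (avg sg g P N) x ∂ν) := fun N => by
    rw [sub_zero, eLpNorm_one_eq_lintegral_enorm, ofReal_integral_eq_lintegral_ofReal
      (integrable_of_continuous (continuous_disp (continuous_avg N)))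
      (Eventually.of_forall (disp_nonneg hP _))]
    exact lintegral_congr fun x => Real.enorm_of_nonneg (disp_nonneg hP _ x)
  simp only [h1]
  rw [← ENNReal.ofReal_zero]
  refine ENNReal.tendsto_ofReal (squeeze_zero (fun N => integral_nonneg (disp_nonneg hP _))
    (hν.integral_disp_avg_le hP hG hg) ?_)
  have h2 := (tendsto_inv_atTop_nhds_zero_nat (𝕜 := ℝ)).const_mul (4 * G ^ 2)
  rwa [mul_zero] at h2

lemma Invariant.exists_subseq (hP : Stoch P) (hν : Invariant sg P ν) (g : Ω → A → ℝ) :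
    ∃ (ns : ℕ → ℕ), StrictMono ns ∧ ∀ᵐ x ∂ν,
      (∃ l, Tendsto (fun k => avg sg g P (ns k) x) atTop (𝓝 l)) ∧
      Tendsto (fun k => disp sg P (avg sg g P (ns k)) x) atTop (𝓝 0) := by
  obtain ⟨c, hc⟩ := hν.tendstoInMeasure_avg hP g
  obtain ⟨ns, hns, h1⟩ := hc.exists_seq_tendsto_ae
  have h2 := (hν.tendstoInMeasure_disp hP g).comp hns.tendsto_atTop
  obtain ⟨ms, hms, h3⟩ := h2.exists_seq_tendsto_ae
  refine ⟨ns ∘ ms, hns.comp hms, ?_⟩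
  filter_upwards [h1, h3] with x hx1 hx3
  exact ⟨⟨c x, hx1.comp hms.tendsto_atTop⟩, hx3⟩

end Ergodic

end TreeChain

namespace TreeChain

open Topology MeasureTheory

set_option linter.unusedSectionVars false

section Absorbing

variable {Ω A : Type*} [Fintype Ω] {sg : Ω → Ω} {g : Ω → A → ℝ} {P : Ω → A → Ω → ℝ}

/-- The states from which a property persists for `n` transitions. -/
def persist (sg : Ω → Ω) (P : Ω → A → Ω → ℝ) (p : Set (Ω × Tree Ω A)) : ℕ → Set (Ω × Tree Ω A)
  | 0 => p
  | n + 1 => {x | x ∈ persist sg P p n ∧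
      ∀ ω', P x.1 (x.2 []) ω' ≠ 0 → next sg x ω' ∈ persist sg P p n}

lemma tendsto_next (hP : Stoch P) {ns : ℕ → ℕ} {x : Ω × Tree Ω A} {ω' : Ω}
    (h0 : P x.1 (x.2 []) ω' ≠ 0) {l l' : ℝ}
    (hx : Tendsto (fun k => avg sg g P (ns k) x) atTop (𝓝 l))
    (hx' : Tendsto (fun k => avg sg g P (ns k) (next sg x ω')) atTop (𝓝 l'))
    (hd : Tendsto (fun k => disp sg P (avg sg g P (ns k)) x) atTop (𝓝 0)) : l' = l := by
  have h1 : Tendsto (fun k => P x.1 (x.2 []) ω' *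
      (avg sg g P (ns k) (next sg x ω') - avg sg g P (ns k) x) ^ 2) atTop
      (𝓝 (P x.1 (x.2 []) ω' * (l' - l) ^ 2)) := ((hx'.sub hx).pow 2).const_mul _
  have h2 : P x.1 (x.2 []) ω' * (l' - l) ^ 2 ≤ 0 :=
    le_of_tendsto_of_tendsto' h1 hd fun k => Finset.single_le_sum
      (f := fun ω' => P x.1 (x.2 []) ω' *
        (avg sg g P (ns k) (next sg x ω') - avg sg g P (ns k) x) ^ 2)
      (fun _ _ => mul_nonneg (hP.1 _ _ _) (sq_nonneg _)) (Finset.mem_univ ω')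
  have h3 : 0 < P x.1 (x.2 []) ω' := (hP.1 _ _ _).lt_of_ne' h0
  have h4 : (l' - l) ^ 2 = 0 := le_antisymm (by nlinarith) (sq_nonneg _)
  exact sub_eq_zero.1 (pow_eq_zero_iff two_ne_zero |>.1 h4)

variable [TopologicalSpace Ω] [DiscreteTopology Ω] [TopologicalSpace A] [DiscreteTopology A]
variable [MeasurableSpace Ω] [BorelSpace Ω] [Finite A] [MeasurableSpace A] [BorelSpace A]
variable {ν : Measure (Ω × Tree Ω A)} [IsProbabilityMeasure ν]

lemma measurableSet_persist {p : Set (Ω × Tree Ω A)} (hp : MeasurableSet p) (n : ℕ) :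
    MeasurableSet (persist sg P p n) := by
  induction n with
  | zero => exact hp
  | succ n ih =>
    have h : persist sg P p (n + 1) = persist sg P p n ∩ ⋂ ω',
        ({x | P x.1 (x.2 []) ω' = 0} ∪ (next sg · ω') ⁻¹' persist sg P p n) := by
      ext x
      simp [persist, or_iff_not_imp_left]
    rw [h]
    refine ih.inter (MeasurableSet.iInter fun ω' => MeasurableSet.union ?_
      ((continuous_next ω').measurable ih))
    exact (continuous_of_stage fun ω a => P ω a ω').measurable (measurableSet_singleton 0)

lemma Invariant.ae_persist (hP : Stoch P) (hν : Invariant sg P ν) {p : Set (Ω × Tree Ω A)}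
    (hp : ∀ᵐ x ∂ν, x ∈ p) (n : ℕ) : ∀ᵐ x ∂ν, x ∈ persist sg P p n := by
  induction n with
  | zero => exact hp
  | succ n ih => exact ih.and (hν.ae_next hP ih)

lemma Invariant.integral_trans_pow (hν : Invariant sg P ν) {φ : Ω × Tree Ω A → ℝ}
    (hφ : Continuous φ) (n : ℕ) : ∫ x, (trans sg P ^ n) φ x ∂ν = ∫ x, φ x ∂ν := by
  induction n with
  | zero => rfl
  | succ n ih => rw [pow_succ', Module.End.mul_apply, hν _ (continuous_trans_pow hφ n), ih]

lemma Invariant.integral_avg (hν : Invariant sg P ν) (g : Ω → A → ℝ) {N : ℕ} (hN : N ≠ 0) :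
    ∫ x, avg sg g P N x ∂ν = ∫ x, pay g x ∂ν := by
  have h : avg sg g P N = fun x => (N : ℝ)⁻¹ * ∑ n ∈ Finset.range N, (trans sg P ^ n) (pay g) x := by
    ext x; simp [avg, tot]
  rw [h, integral_const_mul, integral_finsetSum _ fun n _ =>
    integrable_of_continuous (continuous_trans_pow continuous_pay n)]
  simp only [hν.integral_trans_pow continuous_pay, Finset.sum_const, Finset.card_range,
    nsmul_eq_mul]
  field_simp

lemma Invariant.exists_absorbing (hP : Stoch P) (hν : Invariant sg P ν) {G : ℝ} (hG : 0 ≤ G)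
    (hg : ∀ ω a, |g ω a| ≤ G) :
    ∃ (B : Set (Ω × Tree Ω A)) (c : Ω × Tree Ω A → ℝ),
      MeasurableSet B ∧ (∀ᵐ x ∂ν, x ∈ B) ∧ Measurable c ∧ (∀ x ∈ B, |c x| ≤ G) ∧
      (∀ z ∈ B, ∀ ω', P z.1 (z.2 []) ω' ≠ 0 → next sg z ω' ∈ B ∧ c (next sg z ω') = c z) ∧
      (∀ σ, ∀ ε > 0, ∃ N : ℕ, 1 ≤ N ∧ ∀ ω, (ω, σ) ∈ B →
        (c (ω, σ) - ε) * N ≤ tot sg g P N (ω, σ)) ∧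
      ∫ x, c x ∂ν = ∫ x, pay g x ∂ν := by
  obtain ⟨ns, hns, hae⟩ := hν.exists_subseq hP g
  set good : Set (Ω × Tree Ω A) := {x | (∃ l, Tendsto (fun k => avg sg g P (ns k) x) atTop (𝓝 l)) ∧
    Tendsto (fun k => disp sg P (avg sg g P (ns k)) x) atTop (𝓝 0)} with hgood
  have hgm : MeasurableSet good :=
    (measurableSet_exists_tendsto fun k => (continuous_avg (ns k)).measurable).inter
      (measurableSet_tendsto _ fun k => (continuous_disp (continuous_avg (ns k))).measurable)
  set c : Ω × Tree Ω A → ℝ := fun x => limsup (fun k => avg sg g P (ns k) x) atTop with hc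
  have hcl : ∀ x ∈ good, Tendsto (fun k => avg sg g P (ns k) x) atTop (𝓝 (c x)) := fun x hx => by
    obtain ⟨l, hl⟩ := hx.1
    simpa only [hc, hl.limsup_eq] using hl
  have hcm : Measurable c := Measurable.limsup fun k => (continuous_avg (ns k)).measurable
  have hB : ∀ x ∈ ⋂ n, persist sg P good n, x ∈ good := fun x hx => Set.mem_iInter.1 hx 0
  refine ⟨⋂ n, persist sg P good n, c, MeasurableSet.iInter fun n => measurableSet_persist hgm n,
    ?_, hcm, fun x hx => ?_, fun z hz ω' h0 => ?_, fun σ ε hε => ?_, ?_⟩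
  · filter_upwards [ae_all_iff.2 fun n => hν.ae_persist hP hae n] with x hx
    exact Set.mem_iInter.2 hx
  · exact le_of_tendsto' (hcl x (hB x hx)).abs fun k => abs_avg_le hP hG hg _ _
  · have hz' : next sg z ω' ∈ ⋂ n, persist sg P good n :=
      Set.mem_iInter.2 fun n => (Set.mem_iInter.1 hz (n + 1)).2 ω' h0
    exact ⟨hz', tendsto_next hP h0 (hcl z (hB z hz)) (hcl _ (hB _ hz')) (hB z hz).2⟩
  · have h1 : ∀ᶠ k in atTop, ∀ ω, (ω, σ) ∈ ⋂ n, persist sg P good n →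
        c (ω, σ) - ε < avg sg g P (ns k) (ω, σ) := eventually_all.2 fun ω => by
      by_cases hω : (ω, σ) ∈ ⋂ n, persist sg P good n
      · filter_upwards [(hcl _ (hB _ hω)).eventually_const_lt (sub_lt_self _ hε)] with k hk _
          using hk
      · exact Eventually.of_forall fun k h => absurd h hω
    obtain ⟨k, hk1, hk2⟩ := (h1.and (hns.tendsto_atTop.eventually_ge_atTop 1)).exists
    refine ⟨ns k, hk2, fun ω hω => ?_⟩
    have h2 := (hk1 ω hω).le
    have h3 : (0 : ℝ) < ns k := by exact_mod_cast hk2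
    rw [avg, Pi.smul_apply, smul_eq_mul, inv_mul_eq_div, le_div_iff₀ h3] at h2
    exact h2
  · have h1 : Tendsto (fun k => ∫ x, avg sg g P (ns k) x ∂ν) atTop (𝓝 (∫ x, c x ∂ν)) :=
      tendsto_integral_of_dominated_convergence (fun _ => G)
        (fun k => (continuous_avg (ns k)).aestronglyMeasurable) (integrable_const _)
        (fun k => Eventually.of_forall fun x => abs_avg_le hP hG hg _ _)
        (hae.mono hcl)
    refine tendsto_nhds_unique h1 (tendsto_const_nhds.congr' ?_)
    filter_upwards [hns.tendsto_atTop.eventually_ge_atTop 1] with k hk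
    exact (hν.integral_avg g (by omega)).symm

end Absorbing

end TreeChain

namespace TreeChain

open Topology MeasureTheory

set_option linter.unusedSectionVars false

/-- A sequence of normalized positive functionals on a compact space converges along a fixed
ultrafilter to the integral against a probability measure. -/
lemma exists_tendsto_integral {X : Type*} [TopologicalSpace X] [CompactSpace X] [T2Space X]
    [MeasurableSpace X] [BorelSpace X] (Λ : ℕ → (X → ℝ) →ₗ[ℝ] ℝ)
    (hpos : ∀ T φ, 0 ≤ φ → 0 ≤ Λ T φ) (hone : ∀ T, Λ T (fun _ => 1) = 1) :
    ∃ ν : Measure X, IsProbabilityMeasure ν ∧ ∀ φ : X → ℝ, Continuous φ →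
      Tendsto (fun T => Λ T φ) (hyperfilter ℕ) (𝓝 (∫ x, φ x ∂ν)) := by
  have hex : ∀ φ : C(X, ℝ), ∃ l, Tendsto (fun T => Λ T φ) (hyperfilter ℕ) (𝓝 l) := fun φ => by
    have hle : ∀ T, Λ T φ ∈ Set.Icc (-‖φ‖) ‖φ‖ := fun T => by
      have h1 := hpos T ((‖φ‖ • (fun _ : X => (1 : ℝ))) - ⇑φ) fun x => by
        have := φ.norm_coe_le_norm x
        have h2 := le_abs_self (φ x)
        simp only [Real.norm_eq_abs] at this
        simp only [Pi.zero_apply, Pi.sub_apply, Pi.smul_apply, smul_eq_mul, mul_one]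
        linarith
      have h2 := hpos T ((‖φ‖ • (fun _ : X => (1 : ℝ))) + ⇑φ) fun x => by
        have := φ.norm_coe_le_norm x
        have h2 := neg_abs_le (φ x)
        simp only [Real.norm_eq_abs] at this
        simp only [Pi.zero_apply, Pi.add_apply, Pi.smul_apply, smul_eq_mul, mul_one]
        linarith
      simp only [map_sub, map_add, map_smul, hone, smul_eq_mul, mul_one] at h1 h2
      constructor <;> linarith
    have hmem : ∀ᶠ T in (hyperfilter ℕ : Filter ℕ), Λ T φ ∈ Set.Icc (-‖φ‖) ‖φ‖ :=
      Eventually.of_forall hle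
    obtain ⟨l, -, hl⟩ := isCompact_Icc.ultrafilter_le_nhds'
      ((hyperfilter ℕ).map fun T => Λ T φ) hmem
    exact ⟨l, hl⟩
  choose L hL using hex
  let Λ' : CompactlySupportedContinuousMap X ℝ →ₚ[ℝ] ℝ := PositiveLinearMap.mk₀
    { toFun := fun φ => L φ.toContinuousMap
      map_add' := fun φ ψ => by
        refine tendsto_nhds_unique (hL _) (((hL φ.toContinuousMap).add
          (hL ψ.toContinuousMap)).congr fun T => ?_)
        rw [← map_add]; rfl
      map_smul' := fun r φ => by
        refine tendsto_nhds_unique (hL _) (((hL φ.toContinuousMap).const_mul r).congr fun T => ?_)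
        rw [← smul_eq_mul, ← map_smul]; rfl }
    fun φ hφ => ge_of_tendsto' (hL _) fun T => hpos T _ hφ
  have hint : ∀ φ : X → ℝ, Continuous φ →
      Tendsto (fun T => Λ T φ) (hyperfilter ℕ)
        (𝓝 (∫ x, φ x ∂(RealRMK.rieszMeasure Λ'))) :=
    fun φ hφ => by
      have h1 := RealRMK.integral_rieszMeasure Λ'
        (CompactlySupportedContinuousMap.continuousMapEquiv ⟨φ, hφ⟩)
      have h2 : ∫ x, φ x ∂(RealRMK.rieszMeasure Λ') = L ⟨φ, hφ⟩ := h1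
      rw [h2]
      exact hL ⟨φ, hφ⟩
  refine ⟨RealRMK.rieszMeasure Λ', ⟨?_⟩, hint⟩
  have h1 := tendsto_nhds_unique (hint (fun _ => 1) continuous_const)
    (tendsto_const_nhds.congr fun T => (hone T).symm)
  rw [integral_const, smul_eq_mul, mul_one, Measure.real] at h1
  rwa [ENNReal.toReal_eq_one_iff] at h1

section Occupation

variable {Ω A : Type*} [Fintype Ω] {sg : Ω → Ω} {g : Ω → A → ℝ} {P : Ω → A → Ω → ℝ} {p : Ω → ℝ}

/-- The expectation of `φ` under the `n`-th marginal, when the initial state has law `p` and the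
pure strategy `k s` is used after the first signal `s`. -/
def marginal (sg : Ω → Ω) (P : Ω → A → Ω → ℝ) (p : Ω → ℝ) (k : Ω → Tree Ω A) (n : ℕ)
    (φ : Ω × Tree Ω A → ℝ) : ℝ :=
  ∑ ω, p ω * (trans sg P ^ n) φ (ω, k (sg ω))

lemma marginal_mono (hP : Stoch P) (hp : ∀ ω, 0 ≤ p ω) (k : Ω → Tree Ω A) (n : ℕ)
    {φ ψ : Ω × Tree Ω A → ℝ} (h : φ ≤ ψ) : marginal sg P p k n φ ≤ marginal sg P p k n ψ :=
  Finset.sum_le_sum fun ω _ => mul_le_mul_of_nonneg_left (trans_pow_mono hP n h _) (hp ω)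

lemma marginal_const (hP : Stoch P) (hp1 : ∑ ω, p ω = 1) (k : Ω → Tree Ω A) (n : ℕ) (c : ℝ) :
    marginal sg P p k n (fun _ => c) = c := by
  simp only [marginal, trans_pow_const hP, ← Finset.sum_mul, hp1, one_mul]

/-- The average of the first `T + 1` marginals. -/
noncomputable def occ (sg : Ω → Ω) (P : Ω → A → Ω → ℝ) (p : Ω → ℝ) (k : Ω → Tree Ω A) (T : ℕ) :
    (Ω × Tree Ω A → ℝ) →ₗ[ℝ] ℝ where
  toFun φ := ((T : ℝ) + 1)⁻¹ * ∑ n ∈ Finset.range (T + 1), marginal sg P p k n φ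
  map_add' φ ψ := by
    simp only [marginal, map_add, Pi.add_apply, mul_add, Finset.sum_add_distrib]
  map_smul' r φ := by
    simp only [marginal, map_smul, Pi.smul_apply, smul_eq_mul, RingHom.id_apply, Finset.mul_sum]
    exact Finset.sum_congr rfl fun _ _ => Finset.sum_congr rfl fun _ _ => by ring

lemma occ_apply (k : Ω → Tree Ω A) (T : ℕ) (φ : Ω × Tree Ω A → ℝ) : occ sg P p k T φ =
    ((T : ℝ) + 1)⁻¹ * ∑ n ∈ Finset.range (T + 1), marginal sg P p k n φ := rfl

lemma occ_const (hP : Stoch P) (hp1 : ∑ ω, p ω = 1) (k : Ω → Tree Ω A) (T : ℕ) (c : ℝ) :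
    occ sg P p k T (fun _ => c) = c := by
  have : (T : ℝ) + 1 ≠ 0 := by positivity
  simp only [occ_apply, marginal_const hP hp1, Finset.sum_const, Finset.card_range, nsmul_eq_mul]
  push_cast
  field_simp

lemma exists_lt_marginal_of_lt_occ {k : Ω → Tree Ω A} {T : ℕ} {φ : Ω × Tree Ω A → ℝ} {z : ℝ}
    (h : z < occ sg P p k T φ) : ∃ n, z < marginal sg P p k n φ := by
  by_contra! hc
  have h1 := Finset.sum_le_card_nsmul (Finset.range (T + 1)) _ z fun n _ => hc n
  have h2 : (0 : ℝ) < (T : ℝ) + 1 := by positivity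
  rw [occ_apply, inv_mul_eq_div, lt_div_iff₀ h2] at h
  simp only [Finset.card_range, nsmul_eq_mul] at h1
  push_cast at h1
  linarith

lemma occ_pay (k : Ω → Tree Ω A) (T : ℕ) : occ sg P p k T (pay g) =
    ((T : ℝ) + 1)⁻¹ * ∑ ω, p ω * tot sg g P (T + 1) (ω, k (sg ω)) := by
  simp only [occ_apply, marginal, tot, Finset.sum_apply, Finset.mul_sum]
  rw [Finset.sum_comm]

lemma occ_trans_sub (k : Ω → Tree Ω A) (T : ℕ) (φ : Ω × Tree Ω A → ℝ) :
    occ sg P p k T (trans sg P φ) - occ sg P p k T φ =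
      ((T : ℝ) + 1)⁻¹ * (marginal sg P p k (T + 1) φ - marginal sg P p k 0 φ) := by
  have h : ∀ n, marginal sg P p k n (trans sg P φ) = marginal sg P p k (n + 1) φ := fun n => by
    simp only [marginal, pow_succ, Module.End.mul_apply]
  simp only [occ_apply, h, ← mul_sub, ← Finset.sum_sub_distrib]
  rw [Finset.sum_range_sub fun n => marginal sg P p k n φ]

variable [TopologicalSpace Ω] [DiscreteTopology Ω] [TopologicalSpace A] [DiscreteTopology A]
variable [MeasurableSpace Ω] [BorelSpace Ω] [Finite A] [MeasurableSpace A] [BorelSpace A]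

/-- Limits of occupation measures are invariant. -/
lemma exists_invariant (hP : Stoch P) (hp : ∀ ω, 0 ≤ p ω) (hp1 : ∑ ω, p ω = 1)
    (k : ℕ → Ω → Tree Ω A) :
    ∃ ν : Measure (Ω × Tree Ω A), IsProbabilityMeasure ν ∧ Invariant sg P ν ∧
      ∀ φ : Ω × Tree Ω A → ℝ, Continuous φ →
        Tendsto (fun T => occ sg P p (k T) T φ) (hyperfilter ℕ) (𝓝 (∫ x, φ x ∂ν)) := by
  obtain ⟨ν, hν, hint⟩ := exists_tendsto_integral (fun T => occ sg P p (k T) T)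
    (fun T φ hφ => mul_nonneg (by positivity) (Finset.sum_nonneg fun n _ => by
      rw [← marginal_const (sg := sg) hP hp1 (k T) n 0]
      exact marginal_mono hP hp _ _ hφ)) fun T => occ_const hP hp1 _ _ _
  refine ⟨ν, hν, fun φ hφ => ?_, hint⟩
  refine sub_eq_zero.1 (tendsto_nhds_unique
    ((hint _ (continuous_trans hφ)).sub (hint _ hφ)) ?_)
  simp only [occ_trans_sub]
  obtain ⟨C, hC⟩ := isCompact_univ.exists_bound_of_continuousOn (hφ.continuousOn (s := Set.univ))
  have hm : ∀ k n, |marginal sg P p k n φ| ≤ C := fun k n => by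
    rw [abs_le]
    constructor
    · rw [← marginal_const (sg := sg) hP hp1 k n (-C)]
      exact marginal_mono hP hp _ _ fun x => (abs_le.1 (hC x (Set.mem_univ _))).1
    · rw [← marginal_const (sg := sg) hP hp1 k n C]
      exact marginal_mono hP hp _ _ fun x => (abs_le.1 (hC x (Set.mem_univ _))).2
  have h1 : Tendsto (fun T : ℕ => ((T : ℝ) + 1)⁻¹) (hyperfilter ℕ) (𝓝 0) := by
    have := tendsto_one_div_add_atTop_nhds_zero_nat (𝕜 := ℝ)
    simp only [one_div] at this
    exact this.mono_left Nat.hyperfilter_le_atTop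
  refine h1.zero_mul_isBoundedUnder_le ⟨2 * C, eventually_map.2 (Eventually.of_forall fun T => ?_)⟩
  simp only [Real.norm_eq_abs, Function.comp]
  exact (abs_sub _ _).trans (by linarith [hm (k T) (T + 1), hm (k T) 0])

end Occupation

end TreeChain

namespace TreeChain

open Topology MeasureTheory

set_option linter.unusedSectionVars false

section Main

variable {Ω A : Type*} [Fintype Ω] {sg : Ω → Ω} {g : Ω → A → ℝ} {Q : ℝ → Ω → A → Ω → ℝ} {h₀ : ℝ}
  {p : Ω → ℝ}

variable [TopologicalSpace Ω] [DiscreteTopology Ω] [TopologicalSpace A] [DiscreteTopology A]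
variable [MeasurableSpace Ω] [BorelSpace Ω] [Finite A] [MeasurableSpace A] [BorelSpace A]

/-- If robust vectors have `ν`-integral `y`, then a continuous minorant of robust vectors has
integral almost `y`. -/
lemma exists_continuous_le_robust {ν : Measure (Ω × Tree Ω A)} [IsProbabilityMeasure ν]
    {c : Ω × Tree Ω A → ℝ} (hcm : Measurable c) {G : ℝ} (hcG : ∀ x, |c x| ≤ G)
    (hc : ∀ τ, Robust sg g Q h₀ fun ω => c (ω, τ)) {ε : ℝ} (hε : 0 < ε) :
    ∃ φ ψ : Ω × Tree Ω A → ℝ, Continuous φ ∧ φ ≤ ψ ∧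
      (∀ τ, Robust sg g Q h₀ fun ω => ψ (ω, τ)) ∧ ∫ x, c x ∂ν - ε ≤ ∫ x, φ x ∂ν := by
  set δ : ℝ := ε / 3 / (Fintype.card Ω + 1) with hδ
  have hδ0 : 0 < δ := by positivity
  set μ : Measure (Tree Ω A) := ν.map Prod.snd with hμ
  have hμp : IsProbabilityMeasure μ := Measure.isProbabilityMeasure_map measurable_snd.aemeasurable
  have hcω : ∀ ω, Measurable fun τ : Tree Ω A => c (ω, τ) := fun ω =>
    hcm.comp (measurable_const.prodMk measurable_id)
  have hcint : ∀ ω, Integrable (fun τ : Tree Ω A => c (ω, τ)) μ := fun ω =>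
    (integrable_const G).mono' (hcω ω).aestronglyMeasurable (Eventually.of_forall fun τ => hcG _)
  choose u hu _ using fun ω => (hcint ω).exists_boundedContinuous_integral_sub_le hδ0
  set d : Tree Ω A → ℝ := fun τ => Metric.infDist (fun ω => u ω τ) {r | Robust sg g Q h₀ r} with hd
  have hne : ({r | Robust sg g Q h₀ r} : Set (Ω → ℝ)).Nonempty := by
    obtain ⟨x⟩ : Nonempty (Ω × Tree Ω A) := nonempty_of_isProbabilityMeasure ν
    exact ⟨_, hc x.2⟩
  have hdc : Continuous d := (Metric.continuous_infDist_pt _).comp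
    (continuous_pi fun ω => (u ω).continuous)
  have hex : ∀ τ, ∃ r, Robust sg g Q h₀ r ∧ dist (fun ω => u ω τ) r < d τ + ε / 3 := fun τ =>
    (Metric.infDist_lt_iff hne).1 (by simp only [hd]; linarith)
  choose r hr hur using hex
  set e : Tree Ω A → ℝ := fun τ => ∑ ω, |c (ω, τ) - u ω τ| with he
  have hei : ∀ ω, Integrable (fun τ => |c (ω, τ) - u ω τ|) μ := fun ω =>
    ((hcint ω).sub ((u ω).integrable μ)).abs
  have heν : Integrable (fun x : Ω × Tree Ω A => e x.2) ν :=
    (integrable_finsetSum _ fun ω _ => hei ω).comp_measurable measurable_snd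
  have he_le : ∫ x : Ω × Tree Ω A, e x.2 ∂ν ≤ ε / 3 := by
    have h1 : ∫ x : Ω × Tree Ω A, e x.2 ∂ν = ∫ τ, e τ ∂μ :=
      (integral_map measurable_snd.aemeasurable
        (integrable_finsetSum _ fun ω _ => hei ω).aestronglyMeasurable).symm
    rw [h1, integral_finsetSum _ fun ω _ => hei ω]
    have h2 := Finset.sum_le_card_nsmul Finset.univ _ δ fun ω _ => hu ω
    simp only [Finset.card_univ, nsmul_eq_mul, Real.norm_eq_abs] at h2
    refine h2.trans ?_
    have h3 : ((Fintype.card Ω : ℝ) + 1) * δ = ε / 3 := by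
      rw [hδ]; field_simp
    linarith
  have hce : ∀ ω τ, |c (ω, τ) - u ω τ| ≤ e τ := fun ω τ =>
    Finset.single_le_sum (f := fun ω => |c (ω, τ) - u ω τ|) (fun _ _ => abs_nonneg _)
      (Finset.mem_univ ω)
  have hde : ∀ τ, d τ ≤ e τ := fun τ => by
    refine (Metric.infDist_le_dist_of_mem (hc τ)).trans ?_
    refine (dist_pi_le_iff (Finset.sum_nonneg fun _ _ => abs_nonneg _)).2 fun ω => ?_
    rw [Real.dist_eq, abs_sub_comm]
    exact hce ω τ
  have hφc : Continuous fun x : Ω × Tree Ω A => u x.1 x.2 - d x.2 - ε / 3 := by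
    refine Continuous.sub (Continuous.sub ?_ (hdc.comp continuous_snd)) continuous_const
    exact continuous_prod_of_discrete_left.2 fun ω => (u ω).continuous
  have hcν : Integrable c ν := (integrable_const G).mono' hcm.aestronglyMeasurable
    (Eventually.of_forall hcG)
  have hde2 : Integrable (fun x : Ω × Tree Ω A => c x - 2 * e x.2) ν :=
    hcν.sub (heν.const_mul 2)
  refine ⟨fun x => u x.1 x.2 - d x.2 - ε / 3, fun x => r x.2 x.1, hφc, fun x => ?_, hr, ?_⟩
  · have h1 := (dist_le_pi_dist (fun ω => u ω x.2) (r x.2) x.1).trans (hur x.2).le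
    rw [Real.dist_eq] at h1
    have h2 := (abs_le.1 h1).2
    simp only
    linarith
  · have h1 : ∫ x, c x ∂ν - 2 * ∫ x, e x.2 ∂ν - ε / 3 ≤
        ∫ x : Ω × Tree Ω A, (u x.1 x.2 - d x.2 - ε / 3) ∂ν := by
      have h2 : ∫ x : Ω × Tree Ω A, (c x - 2 * e x.2 - ε / 3) ∂ν =
          ∫ x, c x ∂ν - 2 * ∫ x, e x.2 ∂ν - ε / 3 := by
        rw [integral_sub hde2 (integrable_const _),
          integral_sub hcν (heν.const_mul 2), integral_const_mul, integral_const]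
        simp
      rw [← h2]
      refine integral_mono (hde2.sub (integrable_const _))
        (integrable_of_continuous hφc) fun x => ?_
      have h3 := (abs_le.1 (hce x.1 x.2)).2
      have h4 := hde x.2
      simp only
      linarith
    linarith

lemma exists_robust_strategy [Nonempty A]
    (hQ : ∀ ω a ω', ContinuousAt (fun h => Q h ω a ω') h₀)
    (hS : ∀ᶠ h in 𝓝 h₀, Stoch (Q h))
    (hsupp : ∀ᶠ h in 𝓝 h₀, ∀ ω a ω', Q h ω a ω' ≠ 0 → Q h₀ ω a ω' ≠ 0)
    (hp : ∀ ω, 0 ≤ p ω) (hp1 : ∑ ω, p ω = 1) {y : ℝ}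
    (hy : ∀ᶠ T : ℕ in atTop, ∃ k : Ω → Tree Ω A,
      y * T ≤ ∑ ω, p ω * tot sg g (Q h₀) T (ω, k (sg ω))) {ε : ℝ} (hε : 0 < ε) :
    ∃ k : Ω → Tree Ω A, ∀ᶠ h in 𝓝 h₀, ∀ᶠ T : ℕ in atTop,
      (y - ε) * T ≤ ∑ ω, p ω * tot sg g (Q h) T (ω, k (sg ω)) := by
  classical
  obtain ⟨G, hG, hg⟩ : ∃ G : ℝ, 0 ≤ G ∧ ∀ ω a, |g ω a| ≤ G := by
    obtain ⟨G, hG⟩ := Finite.bddAbove_range fun z : Ω × A => |g z.1 z.2|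
    exact ⟨max G 0, le_max_right _ _, fun ω a => (hG ⟨(ω, a), rfl⟩).trans (le_max_left _ _)⟩
  have hP : Stoch (Q h₀) := hS.self_of_nhds
  obtain ⟨k, hk⟩ := hy.choice
  obtain ⟨ν, hν, hinv, hlim⟩ := exists_invariant (sg := sg) hP hp hp1 fun T => k (T + 1)
  have hpay : y ≤ ∫ x, pay g x ∂ν := by
    refine ge_of_tendsto (hlim _ continuous_pay) (Nat.hyperfilter_le_atTop ?_)
    filter_upwards [(tendsto_add_atTop_nat 1).eventually hk] with T hT
    rw [occ_pay, inv_mul_eq_div, le_div_iff₀ (by positivity)]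
    exact_mod_cast hT
  obtain ⟨B, c, hBm, hBae, hcm, hcG, hB, havg, hcint⟩ := hinv.exists_absorbing hP hG hg
  have hrob := robust_of_absorbing (sg := sg) hQ hS hsupp hg hB havg
  have hm : Measurable fun x : Ω × Tree Ω A => if x ∈ B then c x else -G :=
    hcm.ite hBm measurable_const
  obtain ⟨φ, ψ, hφ, hφψ, hψ, hint⟩ := exists_continuous_le_robust (ν := ν) hm (G := G)
    (fun x => by
      split_ifs with hx
      · exact hcG x hx
      · rw [abs_neg, abs_of_nonneg hG]) (fun τ => by convert hrob τ) (half_pos (half_pos hε))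
  have hint' : ∫ x, (if x ∈ B then c x else -G) ∂ν = ∫ x, c x ∂ν :=
    integral_congr_ae (hBae.mono fun x hx => if_pos hx)
  rw [hint', hcint] at hint
  obtain ⟨T, hT⟩ := ((hlim φ hφ).eventually_const_lt
    (show y - ε / 2 < _ by linarith)).exists
  obtain ⟨n, hn⟩ := exists_lt_marginal_of_lt_occ hT
  have hn' := hn.trans_le (marginal_mono (sg := sg) hP hp (k (T + 1)) n hφψ)
  obtain ⟨k', hk'⟩ := robust_initial hp hp1
    (fun s => Robust.trans_pow hQ hS hg n hψ (k (T + 1) s)) (half_pos hε)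
  refine ⟨k', hk'.mono fun h hh => hh.mono fun t ht => le_trans ?_ ht⟩
  refine mul_le_mul_of_nonneg_right ?_ t.cast_nonneg
  rw [marginal] at hn'
  linarith

end Main

end TreeChain

namespace POMDP

open Topology

set_option linter.unusedSectionVars false

variable {Ω A S : Type*} [Fintype Ω] [Fintype A] {M : POMDP Ω A S} {σ : Strategy S A}

section Behavior

/-- The transition operator on functions of the past and the current state, under `σ`. -/
noncomputable def behTrans (M : POMDP Ω A S) (σ : Strategy S A) :
    (List (S × A) → Ω → ℝ) →ₗ[ℝ] (List (S × A) → Ω → ℝ) where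
  toFun φ past ω := ∑ a, σ (past, M.f ω) a * ∑ ω', M.P ω a ω' * φ ((M.f ω, a) :: past) ω'
  map_add' φ ψ := by
    ext past ω
    simp only [Pi.add_apply, mul_add, Finset.sum_add_distrib]
  map_smul' r φ := by
    ext past ω
    simp only [Pi.smul_apply, smul_eq_mul, RingHom.id_apply, Finset.mul_sum]
    exact Finset.sum_congr rfl fun _ _ => Finset.sum_congr rfl fun _ _ => by ring

/-- The expected stage payoff given the past and the current state. -/
noncomputable def behPay (M : POMDP Ω A S) (σ : Strategy S A) (past : List (S × A)) (ω : Ω) : ℝ :=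
  ∑ a, σ (past, M.f ω) a * M.g ω a

/-- The expected total payoff over `T` stages given the past and the current state. -/
noncomputable def behTot (M : POMDP Ω A S) (σ : Strategy S A) (T : ℕ) :
    List (S × A) → Ω → ℝ :=
  ∑ n ∈ Finset.range T, (behTrans M σ ^ n) (behPay M σ)

lemma behTot_succ (T : ℕ) (past : List (S × A)) (ω : Ω) : behTot M σ (T + 1) past ω =
    ∑ a, σ (past, M.f ω) a *
      (M.g ω a + ∑ ω', M.P ω a ω' * behTot M σ T ((M.f ω, a) :: past) ω') := by
  have h : behTot M σ (T + 1) = behPay M σ + behTrans M σ (behTot M σ T) := by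
    simp only [behTot, map_sum, Finset.sum_range_succ', pow_zero, Module.End.one_apply, pow_succ',
      Module.End.mul_apply]
    rw [add_comm]
  rw [h]
  simp only [mul_add, Finset.sum_add_distrib]
  rfl

@[simp] lemma behTot_zero (past : List (S × A)) (ω : Ω) : behTot M σ 0 past ω = 0 := by
  simp [behTot]

/-- The probability of the next state after a reversed trajectory. -/
def nextP (M : POMDP Ω A S) : List (Ω × A) → Ω → ℝ
  | [], ω => M.p1 ω
  | (ω', a') :: _, ω => M.P ω' a' ω

lemma trajP_cons (ω : Ω) (a : A) (l : List (Ω × A)) :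
    trajP M σ ((ω, a) :: l) = nextP M l ω * σ (M.obs l ω) a * trajP M σ l := by
  cases l <;> rfl

/-- The expectation of a function of the past and the current state after `n` stages. -/
noncomputable def behExp (M : POMDP Ω A S) (σ : Strategy S A) (n : ℕ)
    (φ : List (S × A) → Ω → ℝ) : ℝ :=
  ∑ tr : Fin n → Ω × A, ∑ ω, nextP M (List.ofFn tr) ω * trajP M σ (List.ofFn tr) *
    φ ((List.ofFn tr).map fun z => (M.f z.1, z.2)) ω

lemma sum_fin_succ_fun {X : Type*} [Fintype X] (n : ℕ) (F : (Fin (n + 1) → X) → ℝ) :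
    ∑ tr, F tr = ∑ tr : Fin n → X, ∑ z, F (Fin.cons z tr) := by
  rw [← (Fin.consEquiv fun _ : Fin (n + 1) => X).sum_comp, Fintype.sum_prod_type,
    Finset.sum_comm]
  rfl

lemma behExp_succ (n : ℕ) (φ : List (S × A) → Ω → ℝ) :
    behExp M σ (n + 1) φ = behExp M σ n (behTrans M σ φ) := by
  rw [behExp, sum_fin_succ_fun]
  refine Finset.sum_congr rfl fun tr _ => ?_
  rw [Fintype.sum_prod_type]
  refine Finset.sum_congr rfl fun ω _ => ?_
  simp only [behTrans, LinearMap.coe_mk, AddHom.coe_mk, Finset.mul_sum]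
  refine Finset.sum_congr rfl fun a _ => Finset.sum_congr rfl fun ω' _ => ?_
  rw [List.ofFn_cons, trajP_cons]
  simp only [nextP, obs, List.map_cons]
  ring

lemma stageE_eq_behExp (n : ℕ) : stageE M σ n = behExp M σ n (behPay M σ) := by
  rw [stageE, sum_fin_succ_fun]
  refine Finset.sum_congr rfl fun tr _ => ?_
  rw [Fintype.sum_prod_type]
  refine Finset.sum_congr rfl fun ω _ => ?_
  simp only [behPay, Finset.mul_sum]
  refine Finset.sum_congr rfl fun a _ => ?_
  rw [List.ofFn_cons, trajP_cons]
  simp only [obs, Fin.cons_zero]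
  ring

lemma behExp_eq (n : ℕ) (φ : List (S × A) → Ω → ℝ) :
    behExp M σ n φ = ∑ ω, M.p1 ω * (behTrans M σ ^ n) φ [] ω := by
  induction n generalizing φ with
  | zero => simp [behExp, nextP, trajP]
  | succ n ih => rw [behExp_succ, ih, pow_succ, Module.End.mul_apply]

lemma sum_stageE (T : ℕ) :
    ∑ n ∈ Finset.range T, stageE M σ n = ∑ ω, M.p1 ω * behTot M σ T [] ω := by
  simp only [stageE_eq_behExp, behExp_eq, behTot, Finset.sum_apply, Finset.mul_sum]
  rw [Finset.sum_comm]

lemma abs_behTot_le (hM : M.IsValid) (hσ : IsStrategy σ) {G : ℝ} (hg : ∀ ω a, |M.g ω a| ≤ G)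
    (T : ℕ) (past : List (S × A)) (ω : Ω) : |behTot M σ T past ω| ≤ G * T := by
  induction T generalizing past ω with
  | zero => simp
  | succ T ih =>
    rw [behTot_succ]
    calc _ ≤ ∑ a, |σ (past, M.f ω) a *
          (M.g ω a + ∑ ω', M.P ω a ω' * behTot M σ T ((M.f ω, a) :: past) ω')| :=
          Finset.abs_sum_le_sum_abs _ _
      _ ≤ ∑ a, σ (past, M.f ω) a * (G * (T + 1)) := Finset.sum_le_sum fun a _ => by
          rw [abs_mul, abs_of_nonneg (hσ.1 _ _)]
          refine mul_le_mul_of_nonneg_left ?_ (hσ.1 _ _)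
          have h1 : |∑ ω', M.P ω a ω' * behTot M σ T ((M.f ω, a) :: past) ω'| ≤ G * T :=
            calc _ ≤ ∑ ω', |M.P ω a ω' * behTot M σ T ((M.f ω, a) :: past) ω'| :=
                  Finset.abs_sum_le_sum_abs _ _
              _ ≤ ∑ ω', M.P ω a ω' * (G * T) := Finset.sum_le_sum fun ω' _ => by
                  rw [abs_mul, abs_of_nonneg (hM.1 _ _ _)]
                  exact mul_le_mul_of_nonneg_left (ih _ _) (hM.1 _ _ _)
              _ = G * T := by rw [← Finset.sum_mul, hM.2.1, one_mul]
          have h2 := abs_add_le (M.g ω a) (∑ ω', M.P ω a ω' * behTot M σ T ((M.f ω, a) :: past) ω')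
          linarith [hg ω a]
      _ = G * (T + 1 : ℕ) := by rw [← Finset.sum_mul, hσ.2, one_mul]; push_cast; rfl

lemma abs_avg_le (hM : M.IsValid) (hσ : IsStrategy σ) {G : ℝ} (hG : 0 ≤ G)
    (hg : ∀ ω a, |M.g ω a| ≤ G) (T : ℕ) :
    |1 / (T : ℝ) * ∑ n ∈ Finset.range T, stageE M σ n| ≤ G := by
  rw [one_div, abs_mul, abs_inv, Nat.abs_cast, inv_mul_eq_div]
  refine div_le_of_le_mul₀ T.cast_nonneg hG ?_
  rw [sum_stageE]
  calc _ ≤ ∑ ω, |M.p1 ω * behTot M σ T [] ω| := Finset.abs_sum_le_sum_abs _ _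
    _ ≤ ∑ ω, M.p1 ω * (G * T) := Finset.sum_le_sum fun ω _ => by
        rw [abs_mul, abs_of_nonneg (hM.2.2.1 _)]
        exact mul_le_mul_of_nonneg_left (abs_behTot_le hM hσ hg _ _ _) (hM.2.2.1 _)
    _ = G * T := by rw [← Finset.sum_mul, hM.2.2.2, one_mul]

lemma isBoundedUnder_ge_avg (hM : M.IsValid) (hσ : IsStrategy σ) {G : ℝ} (hG : 0 ≤ G)
    (hg : ∀ ω a, |M.g ω a| ≤ G) : IsBoundedUnder (· ≥ ·) atTop
      fun T : ℕ => 1 / (T : ℝ) * ∑ n ∈ Finset.range T, stageE M σ n :=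
  isBoundedUnder_of ⟨-G, fun T => (abs_le.1 (abs_avg_le hM hσ hG hg T)).1⟩

lemma isCoboundedUnder_ge_avg (hM : M.IsValid) (hσ : IsStrategy σ) {G : ℝ} (hG : 0 ≤ G)
    (hg : ∀ ω a, |M.g ω a| ≤ G) : IsCoboundedUnder (· ≥ ·) atTop
      fun T : ℕ => 1 / (T : ℝ) * ∑ n ∈ Finset.range T, stageE M σ n :=
  (isBoundedUnder_of ⟨G, fun T => (abs_le.1 (abs_avg_le hM hσ hG hg T)).2⟩ :
    IsBoundedUnder (· ≤ ·) atTop _).isCoboundedUnder_ge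

lemma R_le (hM : M.IsValid) (hσ : IsStrategy σ) {G : ℝ} (hG : 0 ≤ G)
    (hg : ∀ ω a, |M.g ω a| ≤ G) : M.R σ ≤ G :=
  liminf_le_of_frequently_le
    (Frequently.of_forall fun T => (abs_le.1 (abs_avg_le hM hσ hG hg T)).2)
    (isBoundedUnder_ge_avg hM hσ hG hg)

end Behavior

open TreeChain

section Pure

variable {r : S → Ω}

lemma exists_tree_of_signals (hr : ∀ ω, M.f (r (M.f ω)) = M.f ω) {u : Ω → ℝ}
    {w : Ω × Tree Ω A → ℝ}
    (h : ∀ s (q : Ω → ℝ), (∀ ω, 0 ≤ q ω) → (∀ ω, q ω ≠ 0 → M.f ω = s) →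
      ∃ τ, ∑ ω, q ω * u ω ≤ ∑ ω, q ω * w (ω, τ))
    (q : Ω → ℝ) (hq : ∀ ω, 0 ≤ q ω) :
    ∃ k : Ω → Tree Ω A, ∑ ω, q ω * u ω ≤ ∑ ω, q ω * w (ω, k (r (M.f ω))) := by
  classical
  have h' : ∀ s : Ω, ∃ τ, ∑ ω, (if r (M.f ω) = s then q ω else 0) * u ω ≤
      ∑ ω, (if r (M.f ω) = s then q ω else 0) * w (ω, τ) := fun s =>
    h (M.f s) _ (fun ω => by split_ifs <;> simp [hq]) fun ω hω => by
      rw [← hr ω, (ite_ne_right_iff.1 hω).1]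
  choose k hk using h'
  refine ⟨k, ?_⟩
  have h1 := Finset.sum_le_sum fun s (_ : s ∈ Finset.univ) => hk s
  rw [Finset.sum_comm] at h1
  conv_rhs at h1 => rw [Finset.sum_comm]
  simpa only [ite_mul, zero_mul, Finset.sum_ite_eq, Finset.mem_univ, if_true] using h1

/-- Against a given horizon, behavior strategies do no better than pure ones. -/
lemma exists_tree_behTot_le [Nonempty A] (hM : M.IsValid) (hσ : IsStrategy σ)
    (hr : ∀ ω, M.f (r (M.f ω)) = M.f ω) (T : ℕ) (past : List (S × A)) (s : S) (q : Ω → ℝ)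
    (hq : ∀ ω, 0 ≤ q ω) (hqs : ∀ ω, q ω ≠ 0 → M.f ω = s) :
    ∃ τ, ∑ ω, q ω * behTot M σ T past ω ≤
      ∑ ω, q ω * tot (fun ω => r (M.f ω)) M.g M.P T (ω, τ) := by
  induction T generalizing past s q with
  | zero => exact ⟨fun _ => Classical.arbitrary A, by simp⟩
  | succ T ih =>
    set W : A → ℝ := fun a => ∑ ω, q ω *
      (M.g ω a + ∑ ω', M.P ω a ω' * behTot M σ T ((s, a) :: past) ω') with hW
    obtain ⟨a, ha⟩ := Finite.exists_max W
    have h1 : ∑ ω, q ω * behTot M σ (T + 1) past ω = ∑ b, σ (past, s) b * W b := by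
      have h0 : ∀ b, σ (past, s) b * W b = ∑ ω, σ (past, s) b * (q ω *
          (M.g ω b + ∑ ω', M.P ω b ω' * behTot M σ T ((s, b) :: past) ω')) :=
        fun b => Finset.mul_sum ..
      simp only [h0]
      rw [Finset.sum_comm]
      refine Finset.sum_congr rfl fun ω _ => ?_
      by_cases h0 : q ω = 0
      · simp [h0]
      · rw [behTot_succ, hqs ω h0, Finset.mul_sum]
        exact Finset.sum_congr rfl fun b _ => by ring
    have h2 : ∑ b, σ (past, s) b * W b ≤ W a :=
      (Finset.sum_le_sum fun b _ => mul_le_mul_of_nonneg_left (ha b) (hσ.1 _ b)).trans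
        (by rw [← Finset.sum_mul, hσ.2, one_mul])
    obtain ⟨k, hk⟩ := exists_tree_of_signals (M := M) hr
      (fun s' q' hq' hqs' => ih ((s, a) :: past) s' q' hq' hqs')
      (fun ω' => ∑ ω, q ω * M.P ω a ω')
      (fun ω' => Finset.sum_nonneg fun ω _ => mul_nonneg (hq ω) (hM.1 _ _ _))
    have h3 : ∀ v : Ω → ℝ, ∑ ω, q ω * (M.g ω a + ∑ ω', M.P ω a ω' * v ω') =
        ∑ ω, q ω * M.g ω a + ∑ ω', (∑ ω, q ω * M.P ω a ω') * v ω' := fun v => by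
      simp only [mul_add, Finset.sum_add_distrib, Finset.mul_sum, Finset.sum_mul]
      congr 1
      rw [Finset.sum_comm]
      exact Finset.sum_congr rfl fun _ _ => Finset.sum_congr rfl fun _ _ => by ring
    refine ⟨node a k, ?_⟩
    rw [h1]
    refine h2.trans ?_
    simp only [tot_succ_apply, node_nil, next, shift_node, hW]
    rw [h3, h3]
    linarith

variable [DecidableEq A]

/-- The behavior strategy that plays the pure strategy `k s` after the first signal `s`. -/
def pureStrategy (r : S → Ω) (a₀ : A) (k : Ω → Tree Ω A) : Strategy S A := fun η a =>
  if a = node a₀ k ((η.1.map fun z => r z.1).reverse ++ [r η.2]) then 1 else 0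

lemma isStrategy_pureStrategy (a₀ : A) (k : Ω → Tree Ω A) :
    IsStrategy (pureStrategy r a₀ k) :=
  ⟨fun η a => by unfold pureStrategy; split_ifs <;> simp, fun η => by simp [pureStrategy]⟩

lemma behTot_pureStrategy (a₀ : A) (k : Ω → Tree Ω A) (T : ℕ) (past : List (S × A)) (ω : Ω) :
    behTot M (pureStrategy r a₀ k) T past ω = tot (fun ω => r (M.f ω)) M.g M.P T
      (ω, fun l => node a₀ k ((past.map fun z => r z.1).reverse ++ r (M.f ω) :: l)) := by
  induction T generalizing past ω with
  | zero => simp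
  | succ T ih =>
    rw [behTot_succ, tot_succ_apply]
    simp only [pureStrategy, ite_mul, one_mul, zero_mul, Finset.sum_ite_eq',
      Finset.mem_univ, if_true]
    congr 1
    refine Finset.sum_congr rfl fun ω' _ => ?_
    rw [ih]
    simp only [next, List.map_cons, List.reverse_cons, List.append_assoc, List.singleton_append]
    rfl

lemma sum_stageE_pureStrategy (a₀ : A) (k : Ω → Tree Ω A) (T : ℕ) :
    ∑ n ∈ Finset.range T, stageE M (pureStrategy r a₀ k) n =
      ∑ ω, M.p1 ω * tot (fun ω => r (M.f ω)) M.g M.P T (ω, k (r (M.f ω))) := by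
  rw [sum_stageE]
  exact Finset.sum_congr rfl fun ω _ => by rw [behTot_pureStrategy]; rfl

end Pure

end POMDP

namespace POMDP

open Topology

set_option linter.unusedSectionVars false

open TreeChain

variable {Ω A S : Type*} [Fintype Ω] [Fintype A] [DecidableEq Ω] {M : POMDP Ω A S}

lemma IsValid.dur (hM : M.IsValid) {h : ℝ} (hh : h ∈ Set.Ioo (0 : ℝ) 1) : (M.dur h).IsValid := by
  refine ⟨fun ω a ω' => ?_, fun ω a => ?_, hM.2.2.1, hM.2.2.2⟩
  · refine add_nonneg (mul_nonneg hh.1.le (hM.1 _ _ _)) (mul_nonneg (by linarith [hh.2]) ?_)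
    split_ifs <;> simp
  · simp only [POMDP.dur, Finset.sum_add_distrib, ← Finset.mul_sum, hM.2.1]
    simp

lemma dur_P_ne_zero (hM : M.IsValid) {h h' : ℝ} (hh' : h' ∈ Set.Ioo (0 : ℝ) 1)
    {ω : Ω} {a : A} {ω' : Ω} (H : (M.dur h).P ω a ω' ≠ 0) :
    (M.dur h').P ω a ω' ≠ 0 := by
  have h0 := hM.1 ω a ω'
  have h1 := hh'.1
  have h2 : 0 < 1 - h' := by linarith [hh'.2]
  simp only [dur] at H ⊢
  by_cases hω : ω' = ω
  · simp only [hω, if_true] at h0 ⊢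
    positivity
  · simp only [hω, if_false, mul_zero, add_zero] at H ⊢
    exact mul_ne_zero h1.ne' (right_ne_zero_of_mul H)

lemma continuous_dur_P (ω : Ω) (a : A) (ω' : Ω) : Continuous fun h => (M.dur h).P ω a ω' := by
  simp only [dur]
  fun_prop

lemma stoch_P (hM : M.IsValid) : Stoch M.P := ⟨hM.1, hM.2.1⟩

/-- A pure strategy that is almost optimal at `h₀` is almost as good near `h₀`. -/
lemma exists_strategy_near (hM : M.IsValid) {h₀ : ℝ} (hh₀ : h₀ ∈ Set.Ioo (0 : ℝ) 1)
    {σ : Strategy S A} (hσ : IsStrategy σ) {y : ℝ} (hy : y < (M.dur h₀).R σ) :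
    ∃ σ' : Strategy S A, IsStrategy σ' ∧ ∀ᶠ h in 𝓝 h₀, y < (M.dur h).R σ' := by
  classical
  obtain ⟨ω₀⟩ : Nonempty Ω := by
    by_contra! hne
    simpa using hM.2.2.2
  obtain ⟨a₀⟩ : Nonempty A := by
    by_contra! hne
    simpa using hσ.2 ([], M.f ω₀)
  have : Nonempty Ω := ⟨ω₀⟩
  have : Nonempty A := ⟨a₀⟩
  let : TopologicalSpace Ω := ⊥
  have : DiscreteTopology Ω := ⟨rfl⟩
  let : TopologicalSpace A := ⊥
  have : DiscreteTopology A := ⟨rfl⟩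
  let : MeasurableSpace Ω := borel Ω
  have : BorelSpace Ω := ⟨rfl⟩
  let : MeasurableSpace A := borel A
  have : BorelSpace A := ⟨rfl⟩
  obtain ⟨G, hG, hg⟩ : ∃ G : ℝ, 0 ≤ G ∧ ∀ ω a, |M.g ω a| ≤ G := by
    obtain ⟨G, hG⟩ := Finite.bddAbove_range fun z : Ω × A => |M.g z.1 z.2|
    exact ⟨max G 0, le_max_right _ _, fun ω a => (hG ⟨(ω, a), rfl⟩).trans (le_max_left _ _)⟩
  set r : S → Ω := Function.invFun M.f
  have hr : ∀ ω, M.f (r (M.f ω)) = M.f ω := fun ω => Function.invFun_eq ⟨ω, rfl⟩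
  have hI : ∀ᶠ h in 𝓝 h₀, h ∈ Set.Ioo (0 : ℝ) 1 := isOpen_Ioo.mem_nhds hh₀
  obtain ⟨y', hy', hy''⟩ := exists_between hy
  have h1 : ∀ᶠ T : ℕ in atTop, ∃ k : Ω → Tree Ω A, y' * T ≤
      ∑ ω, M.p1 ω * tot (fun ω => r (M.f ω)) M.g (M.dur h₀).P T (ω, k (r (M.f ω))) := by
    filter_upwards [eventually_lt_of_lt_liminf hy''
      (isBoundedUnder_ge_avg (hM.dur hh₀) hσ hG hg), eventually_gt_atTop 0] with T hT hT0
    obtain ⟨k, hk⟩ := exists_tree_of_signals (M := M.dur h₀) hr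
      (exists_tree_behTot_le (hM.dur hh₀) hσ hr T []) M.p1 hM.2.2.1
    refine ⟨k, le_trans ?_ hk⟩
    rw [one_div, inv_mul_eq_div, lt_div_iff₀ (by exact_mod_cast hT0), sum_stageE] at hT
    exact hT.le
  obtain ⟨k, hk⟩ := exists_robust_strategy (Q := fun h => (M.dur h).P)
    (fun ω a ω' => (continuous_dur_P ω a ω').continuousAt)
    (hI.mono fun h hh => stoch_P (hM.dur hh))
    (hI.mono fun h hh ω a ω' H => dur_P_ne_zero hM hh₀ H) hM.2.2.1 hM.2.2.2 h1
    (half_pos (sub_pos.2 hy'))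
  refine ⟨pureStrategy r a₀ k, isStrategy_pureStrategy a₀ k, ?_⟩
  filter_upwards [hk, hI] with h hkh hh
  refine lt_of_lt_of_le (by linarith : y < y' - (y' - y) / 2) (le_liminf_of_le
    (isCoboundedUnder_ge_avg (hM.dur hh) (isStrategy_pureStrategy a₀ k) hG hg) ?_)
  filter_upwards [hkh, eventually_gt_atTop 0] with T hT hT0
  rw [one_div, inv_mul_eq_div, le_div_iff₀ (by exact_mod_cast hT0), sum_stageE_pureStrategy]
  exact hT

lemma bddAbove_R (hM : M.IsValid) :
    BddAbove {r | ∃ σ : Strategy S A, IsStrategy σ ∧ r = M.R σ} := by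
  obtain ⟨G, hG⟩ := Finite.bddAbove_range fun z : Ω × A => |M.g z.1 z.2|
  refine ⟨max G 0, ?_⟩
  rintro _ ⟨σ, hσ, rfl⟩
  exact R_le hM hσ (le_max_right _ _) fun ω a =>
    (hG ⟨(ω, a), rfl⟩).trans (le_max_left _ _)

end POMDP

/-- The value function `h ↦ V(h)` is lower semi-continuous
on the open interval `(0,1)`. -/
theorem value_lsc {Ω A S : Type*} [Fintype Ω] [Fintype A] [DecidableEq Ω]
    (M : POMDP Ω A S) (hM : M.IsValid) :
    LowerSemicontinuousOn M.V (Set.Ioo (0 : ℝ) 1) := by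
  intro h₀ hh₀ y hy
  by_cases hne : ∃ σ : Strategy S A, IsStrategy σ
  · obtain ⟨σ₀, hσ₀⟩ := hne
    have hy : y < M.V h₀ := hy
    have hS : {r | ∃ σ : Strategy S A, IsStrategy σ ∧ r = (M.dur h₀).R σ}.Nonempty :=
      ⟨_, σ₀, hσ₀, rfl⟩
    obtain ⟨_, ⟨σ, hσ, rfl⟩, hyσ⟩ := exists_lt_of_lt_csSup hS hy
    obtain ⟨σ', hσ', H⟩ := POMDP.exists_strategy_near hM hh₀ hσ hyσ
    filter_upwards [nhdsWithin_le_nhds H, self_mem_nhdsWithin] with h hh hI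
    exact hh.trans_le (le_csSup (POMDP.bddAbove_R (hM.dur hI)) ⟨σ', hσ', rfl⟩)
  · have h0 : ∀ h, M.V h = 0 := fun h => by
      have : {r | ∃ σ : Strategy S A, IsStrategy σ ∧ r = (M.dur h).R σ} = ∅ :=
        Set.eq_empty_of_forall_notMem fun r ⟨σ, hσ, _⟩ => hne ⟨σ, hσ⟩
      rw [POMDP.V, this, Real.sSup_empty]
    have hy : y < M.V h₀ := hy
    refine Eventually.of_forall fun h => ?_
    change y < M.V h
    rwa [h0] at hy ⊢
end

section
/- Consider the state-blind POMDP G₁ with a single signal s₁, action set {a, b}, state set {ω₁, ω₂, ω₃}, initial state ω₁ (p₁ = δ_{ω₁}), payoffs g(ω₁, ·) = g(ω₂, ·) = 1 and g(ω₃, ·) = 0, and deterministic transitions P(ω₂ | ω₁, a) = P(ω₃ | ω₁, b) = P(ω₃ | ω₂, a) = P(ω₁ | ω₂, b) = P(ω₃ | ω₃, a) = P(ω₃ | ω₃, b) = 1. Then V(1) = 1 while V(h) = 0 for every h ∈ (0,1); in particular, h ↦ V(h) is not lower semi-continuous at h = 1. -/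
open Filter

/-- Deterministic transition function of the example: states `0 = ω₁`, `1 = ω₂`,
`2 = ω₃`; action `true = a`, `false = b`. -/
def exNext : Fin 3 → Bool → Fin 3 := fun ω b =>
  if ω = 0 then (if b then 1 else 2)
  else if ω = 1 then (if b then 2 else 0)
  else 2

/-- The state-blind example POMDP: a single signal, two actions, three states,
initial state `ω₁`, payoff `1` on `ω₁, ω₂` and `0` on the absorbing state `ω₃`,
and the deterministic transitions `exNext`. -/
def exM : POMDP (Fin 3) Bool Unit where
  f := fun _ => ()
  g := fun ω _ => if ω = 2 then 0 else 1
  P := fun ω b ω' => if ω' = exNext ω b then 1 else 0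
  p1 := fun ω => if ω = 0 then 1 else 0

section StateBlind

variable {Ω A : Type*}

/-- The history of a state-blind decision maker after the (reversed) action list `l`. -/
def blindHist (l : List A) : Hist Unit A := (l.map fun a => ((), a), ())

lemma obs_eq_blindHist (M : POMDP Ω A Unit) (rev : List (Ω × A)) (ω : Ω) :
    M.obs rev ω = blindHist (rev.map Prod.snd) := by
  simp [POMDP.obs, blindHist, Function.comp_def]

variable [Fintype Ω] [Fintype A]

/-- Expectation of a function of the first `n` actions (listed in reverse) under `σ`. -/
def actionE (σ : Strategy Unit A) : ℕ → (List A → ℝ) → ℝ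
  | 0, G => G []
  | n + 1, G => actionE σ n fun l => ∑ a, σ (blindHist l) a * G (a :: l)

/-- Law of the current state given the (reversed) list of past actions. -/
def belief (M : POMDP Ω A Unit) : List A → Ω → ℝ
  | [] => M.p1
  | a :: l => fun ω' => ∑ ω, belief M l ω * M.P ω a ω'

lemma actionE_mem_Icc {σ : Strategy Unit A} (hσ : IsStrategy σ) {c d : ℝ} (n : ℕ)
    (G : List A → ℝ) (hG : ∀ l, l.length = n → G l ∈ Set.Icc c d) :
    actionE σ n G ∈ Set.Icc c d := by
  induction n generalizing G with
  | zero => exact hG [] rfl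
  | succ n ih =>
    refine ih _ fun l hl => ?_
    have hG' : ∀ a, G (a :: l) ∈ Set.Icc c d := fun a => hG _ (by simp [hl])
    constructor
    · calc c = ∑ a, σ (blindHist l) a * c := by rw [← Finset.sum_mul, hσ.2, one_mul]
        _ ≤ _ := Finset.sum_le_sum fun a _ => mul_le_mul_of_nonneg_left (hG' a).1 (hσ.1 _ _)
    · calc _ ≤ ∑ a, σ (blindHist l) a * d :=
            Finset.sum_le_sum fun a _ => mul_le_mul_of_nonneg_left (hG' a).2 (hσ.1 _ _)
        _ = d := by rw [← Finset.sum_mul, hσ.2, one_mul]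

lemma sum_trajP_mul (M : POMDP Ω A Unit) (σ : Strategy Unit A) (n : ℕ)
    (F : A → List A → Ω → ℝ) :
    ∑ tr : Fin (n + 1) → Ω × A, M.trajP σ (List.ofFn tr) *
        F (tr 0).2 ((List.ofFn fun i => tr (Fin.succ i)).map Prod.snd) (tr 0).1 =
      actionE σ n fun l => ∑ a, σ (blindHist l) a * ∑ ω, belief M l ω * F a l ω := by
  induction n generalizing F with
  | zero =>
    rw [← (Equiv.funUnique (Fin 1) (Ω × A)).symm.sum_comp, Fintype.sum_prod_type,
      Finset.sum_comm]
    suffices ∑ a, ∑ ω, M.p1 ω * σ (blindHist []) a * F a [] ω =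
        ∑ a, ∑ ω, σ (blindHist []) a * (M.p1 ω * F a [] ω) by
      simpa [actionE, belief, POMDP.trajP, obs_eq_blindHist, Finset.mul_sum] using this
    refine Finset.sum_congr rfl fun a _ => Finset.sum_congr rfl fun ω _ => ?_
    ring
  | succ n ih =>
    rw [← (Fin.consEquiv fun _ : Fin (n + 2) => Ω × A).sum_comp, Fintype.sum_prod_type,
      Finset.sum_comm]
    have key := ih fun a l ω₀ => ∑ x : Ω × A,
      M.P ω₀ a x.1 * σ (blindHist (a :: l)) x.2 * F x.2 (a :: l) x.1
    trans ∑ tr : Fin (n + 1) → Ω × A, M.trajP σ (List.ofFn tr) * ∑ x : Ω × A,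
      M.P (tr 0).1 (tr 0).2 x.1 * σ (blindHist ((tr 0).2 ::
        ((List.ofFn fun i => tr (Fin.succ i)).map Prod.snd))) x.2 *
        F x.2 ((tr 0).2 :: ((List.ofFn fun i => tr (Fin.succ i)).map Prod.snd)) x.1
    · refine Finset.sum_congr rfl fun tr _ => ?_
      rw [Finset.mul_sum]
      refine Finset.sum_congr rfl fun x _ => ?_
      simp only [Fin.consEquiv_apply, Fin.cons_zero, Fin.cons_succ, List.ofFn_succ,
        POMDP.trajP, obs_eq_blindHist, List.map_cons]
      ring
    · rw [key]
      simp only [actionE]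
      congr 1
      ext l
      refine Finset.sum_congr rfl fun a _ => ?_
      congr 1
      simp only [belief, Fintype.sum_prod_type, Finset.mul_sum, Finset.sum_mul]
      rw [Finset.sum_congr rfl fun _ _ => Finset.sum_comm, Finset.sum_comm]
      refine Finset.sum_congr rfl fun b _ => ?_
      rw [Finset.sum_comm]
      refine Finset.sum_congr rfl fun ω _ => Finset.sum_congr rfl fun ω₀ _ => ?_
      ring

lemma stageE_eq_actionE (M : POMDP Ω A Unit) {σ : Strategy Unit A} (hσ : IsStrategy σ)
    {r : Ω → ℝ} (hr : ∀ ω a, M.g ω a = r ω) (n : ℕ) :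
    M.stageE σ n = actionE σ n fun l => ∑ ω, belief M l ω * r ω := by
  simp only [POMDP.stageE, hr]
  rw [sum_trajP_mul M σ n fun _ _ ω => r ω]
  simp only [← Finset.sum_mul, hσ.2, one_mul]

end StateBlind

/-- Probability of not being absorbed, given the past actions. -/
noncomputable def alive (h : ℝ) (l : List Bool) : ℝ :=
  belief (exM.dur h) l 0 + belief (exM.dur h) l 1

lemma belief_cons_true (h : ℝ) (l : List Bool) :
    belief (exM.dur h) (true :: l) 0 = (1 - h) * belief (exM.dur h) l 0 ∧
      belief (exM.dur h) (true :: l) 1 =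
        h * belief (exM.dur h) l 0 + (1 - h) * belief (exM.dur h) l 1 := by
  constructor <;> simp [belief, POMDP.dur, exM, exNext, Fin.sum_univ_three] <;> ring

lemma belief_cons_false (h : ℝ) (l : List Bool) :
    belief (exM.dur h) (false :: l) 0 =
        (1 - h) * belief (exM.dur h) l 0 + h * belief (exM.dur h) l 1 ∧
      belief (exM.dur h) (false :: l) 1 = (1 - h) * belief (exM.dur h) l 1 := by
  constructor <;> simp [belief, POMDP.dur, exM, exNext, Fin.sum_univ_three] <;> ring

lemma stageE_exM {σ : Strategy Unit Bool} (hσ : IsStrategy σ) (h : ℝ) (n : ℕ) :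
    (exM.dur h).stageE σ n = actionE σ n (alive h) := by
  rw [stageE_eq_actionE (exM.dur h) hσ (r := fun ω => if ω = 2 then 0 else 1)
    fun _ _ => rfl]
  congr 1
  ext l
  simp [alive, Fin.sum_univ_three]

lemma belief_bounds {h : ℝ} (h0 : 0 ≤ h) (h1 : h ≤ 1) (l : List Bool) :
    0 ≤ belief (exM.dur h) l 0 ∧ 0 ≤ belief (exM.dur h) l 1 ∧ alive h l ≤ 1 := by
  induction l with
  | nil => simp [alive, belief, POMDP.dur, exM]
  | cons a l ih =>
    obtain ⟨hx, hy, hs⟩ := ih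
    have h1' : 0 ≤ 1 - h := sub_nonneg.2 h1
    have hhx := mul_nonneg h0 hx
    have hhy := mul_nonneg h0 hy
    have hhx' := mul_nonneg h1' hx
    have hhy' := mul_nonneg h1' hy
    unfold alive at hs ⊢
    cases a
    · rw [(belief_cons_false h l).1, (belief_cons_false h l).2]
      exact ⟨by linarith, by linarith, by linarith⟩
    · rw [(belief_cons_true h l).1, (belief_cons_true h l).2]
      exact ⟨by linarith, by linarith, by linarith⟩

/-- The Euclidean norm of the non-absorbed part of the belief contracts at each stage. -/
lemma belief_sq_le {h : ℝ} (h0 : 0 ≤ h) (h1 : h ≤ 1) (l : List Bool) :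
    belief (exM.dur h) l 0 ^ 2 + belief (exM.dur h) l 1 ^ 2 ≤
      (1 - h * (1 - h)) ^ l.length := by
  induction l with
  | nil => simp [belief, POMDP.dur, exM]
  | cons a l ih =>
    have hh : 0 ≤ h * (1 - h) := mul_nonneg h0 (sub_nonneg.2 h1)
    have hr : 0 ≤ 1 - h * (1 - h) := by nlinarith
    have contract : ∀ x y : ℝ, ((1 - h) * x) ^ 2 + (h * x + (1 - h) * y) ^ 2 ≤
        (1 - h * (1 - h)) * (x ^ 2 + y ^ 2) := fun x y => by
      nlinarith [mul_nonneg hh (sq_nonneg (x - y)), mul_nonneg (sq_nonneg h) (sq_nonneg y)]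
    rw [List.length_cons, pow_succ' _ l.length]
    refine le_trans ?_ (mul_le_mul_of_nonneg_left ih hr)
    cases a
    · rw [(belief_cons_false h l).1, (belief_cons_false h l).2]
      linarith [contract (belief (exM.dur h) l 1) (belief (exM.dur h) l 0)]
    · rw [(belief_cons_true h l).1, (belief_cons_true h l).2]
      exact contract _ _

lemma alive_le_sqrt {h : ℝ} (h0 : 0 ≤ h) (h1 : h ≤ 1) (l : List Bool) :
    alive h l ≤ √(2 * (1 - h * (1 - h)) ^ l.length) := by
  refine Real.le_sqrt_of_sq_le (le_trans ?_ (mul_le_mul_of_nonneg_left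
    (belief_sq_le h0 h1 l) zero_le_two))
  unfold alive
  nlinarith [sq_nonneg (belief (exM.dur h) l 0 - belief (exM.dur h) l 1)]

lemma stageE_mem_Icc {σ : Strategy Unit Bool} (hσ : IsStrategy σ) {h : ℝ} (h0 : 0 ≤ h)
    (h1 : h ≤ 1) (n : ℕ) : (exM.dur h).stageE σ n ∈ Set.Icc (0 : ℝ) 1 := by
  rw [stageE_exM hσ]
  refine actionE_mem_Icc hσ n _ fun l _ => ?_
  obtain ⟨hx, hy, hs⟩ := belief_bounds h0 h1 l
  exact ⟨add_nonneg hx hy, hs⟩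

lemma R_le_one {σ : Strategy Unit Bool} (hσ : IsStrategy σ) {h : ℝ} (h0 : 0 ≤ h)
    (h1 : h ≤ 1) : (exM.dur h).R σ ≤ 1 := by
  have hnn : ∀ T : ℕ, 0 ≤ (1 / (T : ℝ)) * ∑ n ∈ Finset.range T, (exM.dur h).stageE σ n :=
    fun T => mul_nonneg (by positivity)
      (Finset.sum_nonneg fun n _ => (stageE_mem_Icc hσ h0 h1 n).1)
  refine liminf_le_of_le (isBoundedUnder_of ⟨0, hnn⟩) fun b hb => ?_
  obtain ⟨T, hT⟩ := hb.exists
  refine hT.trans ?_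
  have hsum : ∑ n ∈ Finset.range T, (exM.dur h).stageE σ n ≤ T := by
    simpa using Finset.sum_le_card_nsmul (Finset.range T) _ 1
      fun n _ => (stageE_mem_Icc hσ h0 h1 n).2
  rw [one_div_mul_eq_div]
  exact div_le_one_of_le₀ hsum T.cast_nonneg

lemma R_eq_of_tendsto (M : POMDP (Fin 3) Bool Unit) {σ : Strategy Unit Bool} {c : ℝ}
    (hc : Tendsto (M.stageE σ) atTop (nhds c)) : M.R σ = c := by
  refine Tendsto.liminf_eq ?_
  simpa only [one_div] using hc.cesaro

lemma R_eq_zero {σ : Strategy Unit Bool} (hσ : IsStrategy σ) {h : ℝ}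
    (hh : h ∈ Set.Ioo (0 : ℝ) 1) : (exM.dur h).R σ = 0 := by
  obtain ⟨h0, h1⟩ := hh
  refine R_eq_of_tendsto _ (squeeze_zero (g := fun n => √(2 * (1 - h * (1 - h)) ^ n))
    (fun n => (stageE_mem_Icc hσ h0.le h1.le n).1) (fun n => ?_) ?_)
  · rw [stageE_exM hσ]
    refine (actionE_mem_Icc hσ (c := 0) n _ fun l hl => ?_).2
    obtain ⟨hx, hy, -⟩ := belief_bounds h0.le h1.le l
    exact ⟨add_nonneg hx hy, hl ▸ alive_le_sqrt h0.le h1.le l⟩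
  · have hpow : Tendsto (fun n : ℕ => (1 - h * (1 - h)) ^ n) atTop (nhds 0) :=
      tendsto_pow_atTop_nhds_zero_of_lt_one (by nlinarith) (by nlinarith)
    simpa using (hpow.const_mul 2).sqrt

/-- The strategy playing `a, b, a, b, …`. -/
def alternating : Strategy Unit Bool := fun η a =>
  if a = decide (Even η.1.length) then 1 else 0

/-- The reversed list of the first `n` actions of `alternating`. -/
def alternatingList : ℕ → List Bool
  | 0 => []
  | n + 1 => decide (Even n) :: alternatingList n

lemma alternatingList_length (n : ℕ) : (alternatingList n).length = n := by
  induction n with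
  | zero => rfl
  | succ n ih => simp [alternatingList, ih]

lemma isStrategy_alternating : IsStrategy alternating := by
  constructor
  · intro η a
    unfold alternating
    split_ifs <;> simp
  · intro η
    simp [alternating]

lemma actionE_alternating (n : ℕ) (G : List Bool → ℝ) :
    actionE alternating n G = G (alternatingList n) := by
  induction n generalizing G with
  | zero => rfl
  | succ n ih =>
    rw [actionE, ih]
    simp [alternating, blindHist, alternatingList_length, alternatingList]

lemma belief_alternatingList (n : ℕ) :
    belief (exM.dur 1) (alternatingList n) 0 = (if Even n then 1 else 0) ∧
      belief (exM.dur 1) (alternatingList n) 1 = if Even n then 0 else 1 := by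
  induction n with
  | zero => simp [alternatingList, belief, POMDP.dur, exM]
  | succ n ih =>
    by_cases hn : Even n
    · simp [alternatingList, hn, belief_cons_true, ih, Nat.even_add_one]
    · simp [alternatingList, hn, belief_cons_false, ih, Nat.even_add_one]

lemma R_alternating : (exM.dur 1).R alternating = 1 := by
  refine R_eq_of_tendsto _ (tendsto_const_nhds.congr fun n => ?_)
  rw [stageE_exM isStrategy_alternating, actionE_alternating, alive,
    (belief_alternatingList n).1, (belief_alternatingList n).2]
  split_ifs <;> simp

lemma V_one : exM.V 1 = 1 := by
  refine IsGreatest.csSup_eq ⟨⟨alternating, isStrategy_alternating, R_alternating.symm⟩, ?_⟩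
  rintro r ⟨σ, hσ, rfl⟩
  exact R_le_one hσ zero_le_one le_rfl

lemma V_eq_zero {h : ℝ} (hh : h ∈ Set.Ioo (0 : ℝ) 1) : exM.V h = 0 := by
  refine IsGreatest.csSup_eq
    ⟨⟨alternating, isStrategy_alternating, (R_eq_zero isStrategy_alternating hh).symm⟩, ?_⟩
  rintro r ⟨σ, hσ, rfl⟩
  exact (R_eq_zero hσ hh).le

/-- In the example, `V(1) = 1` while `V(h) = 0` for every
`h ∈ (0,1)`; in particular `h ↦ V(h)` is not lower semi-continuous at `h = 1`
(within `(0,1]`). -/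
theorem example_not_lsc_at_one :
    exM.V 1 = 1 ∧ (∀ h ∈ Set.Ioo (0 : ℝ) 1, exM.V h = 0) ∧
      ¬ LowerSemicontinuousWithinAt exM.V (Set.Ioc (0 : ℝ) 1) 1 := by
  refine ⟨V_one, fun h => V_eq_zero, fun hlsc => ?_⟩
  have hev := hlsc (1 / 2) (show 1 / 2 < exM.V 1 by rw [V_one]; norm_num)
  have : (nhdsWithin (1 : ℝ) (Set.Ioo 0 1)).NeBot := right_nhdsWithin_Ioo_neBot one_pos
  have hev' := hev.filter_mono (nhdsWithin_mono 1 Set.Ioo_subset_Ioc_self)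
  obtain ⟨h, hV, hh⟩ := (hev'.and self_mem_nhdsWithin).exists
  rw [V_eq_zero hh] at hV
  norm_num at hV
end

section
/- Let (Ω, F, P) be a probability space, h ∈ (0,1), M ≥ 0, and let (X_m)_{m≥1} be {0,1}-valued random variables with P(X_m = 1) = h for every m, and (Y_m)_{m≥1} be real random variables with |Y_m| ≤ M almost surely. Assume that for each m ≥ 1, X_m is independent of the σ-algebra generated by (Y_m, X_1, …, X_{m−1}). Let N = inf{m ≥ 1 : X_m = 1}. Then N is almost surely finite, the sum Σ_{m=1}^{N} Y_m is integrable, and E[Σ_{m=1}^{N} Y_m] = (1/h) · E[Y_N]. -/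
open MeasureTheory ProbabilityTheory

/-- If `s` belongs to a σ-algebra independent of one for which `g` is measurable, then
`∫ 1_s g = P(s) ∫ g`. -/
theorem integral_indicator_eq_measureReal_mul_of_indep {Ω : Type*} {m₁ m₂ mΩ : MeasurableSpace Ω}
    {P : Measure Ω} (hind : Indep m₁ m₂ P) (hm₁ : m₁ ≤ mΩ) (hm₂ : m₂ ≤ mΩ)
    {s : Set Ω} (hs : MeasurableSet[m₁] s) {g : Ω → ℝ} (hg : Measurable[m₂] g) :
    ∫ ω, s.indicator g ω ∂P = P.real s * ∫ ω, g ω ∂P := by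
  have hf : Measurable[m₁] (s.indicator (1 : Ω → ℝ)) :=
    Measurable.indicator (@measurable_const _ _ _ m₁ (1 : ℝ)) hs
  have hfg : IndepFun (s.indicator (1 : Ω → ℝ)) g P := by
    rw [IndepFun_iff_Indep]
    exact indep_of_indep_of_le hind hf.comap_le hg.comap_le
  have key := hfg.integral_fun_mul_eq_mul_integral
    (hf.mono hm₁ le_rfl).aestronglyMeasurable (hg.mono hm₂ le_rfl).aestronglyMeasurable
  rw [integral_indicator_one (hm₁ _ hs)] at key
  rw [← key]
  congr 1 with ω
  by_cases hω : ω ∈ s <;> simp [hω]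

/-- An almost everywhere convergent series with summable `L¹` norms has an integrable sum, and can
be integrated term by term. -/
theorem integrable_and_hasSum_integral_of_hasSum {α E : Type*} [MeasurableSpace α]
    [NormedAddCommGroup E] [NormedSpace ℝ E] {μ : Measure α} {F : ℕ → α → E} {S : α → E}
    (hF : ∀ n, Integrable (F n) μ) (hsum : Summable fun n => ∫ a, ‖F n a‖ ∂μ)
    (hS : ∀ᵐ a ∂μ, HasSum (fun n => F n a) (S a)) :
    Integrable S μ ∧ HasSum (fun n => ∫ a, F n a ∂μ) (∫ a, S a ∂μ) := by
  have htsum : (fun a => ∑' n, F n a) =ᵐ[μ] S := by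
    filter_upwards [hS] with a ha using ha.tsum_eq
  refine ⟨⟨?_, ?_⟩, ?_⟩
  · refine aestronglyMeasurable_of_tendsto_ae Filter.atTop
      (f := fun k a => ∑ n ∈ Finset.range k, F n a) (fun k => ?_) ?_
    · exact (integrable_finsetSum _ fun n _ => hF n).aestronglyMeasurable
    · filter_upwards [hS] with a ha using ha.tendsto_sum_nat
  · calc ∫⁻ a, ‖S a‖ₑ ∂μ ≤ ∫⁻ a, ∑' n, ‖F n a‖ₑ ∂μ := by
          refine lintegral_mono_ae ?_
          filter_upwards [htsum] with a ha
          rw [← ha]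
          exact enorm_tsum_le_tsum_enorm
      _ = ∑' n, ENNReal.ofReal (∫ a, ‖F n a‖ ∂μ) := by
          rw [lintegral_tsum fun n => (hF n).aestronglyMeasurable.enorm]
          exact tsum_congr fun n => (ofReal_integral_norm_eq_lintegral_enorm (hF n)).symm
      _ < ⊤ := hsum.tsum_ofReal_ne_top.lt_top
  · rw [← integral_congr_ae htsum]
    exact hasSum_integral_of_summable_integral_norm hF hsum

/-- When finite, the infimum of a set of natural numbers `j ≥ 1` satisfying `p` is its least
element. -/
theorem toNat_sInf_image_spec {p : ℕ → Prop} {n : ℕ∞}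
    (hn : n = sInf ((fun j : ℕ => (j : ℕ∞)) '' {j | 1 ≤ j ∧ p j})) (htop : n ≠ ⊤) :
    1 ≤ n.toNat ∧ p n.toNat ∧ ∀ i, 1 ≤ i → i < n.toNat → ¬ p i := by
  obtain ⟨k, rfl⟩ := ENat.ne_top_iff_exists.mp htop
  have hne : ((fun j : ℕ => (j : ℕ∞)) '' {j | 1 ≤ j ∧ p j}).Nonempty := by
    by_contra hemp
    rw [Set.not_nonempty_iff_eq_empty] at hemp
    rw [hemp, sInf_empty] at hn
    exact htop hn
  obtain ⟨j, ⟨hj1, hj⟩, hjk⟩ := csInf_mem hne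
  have hkj : j = k := by
    rw [← hn] at hjk
    exact Nat.cast_injective hjk
  subst hkj
  refine ⟨by simpa using hj1, by simpa using hj, fun i hi hik hpi => ?_⟩
  have hle : (j : ℕ∞) ≤ i := hn ▸ sInf_le ⟨i, ⟨hi, hpi⟩, rfl⟩
  simp only [ENat.toNat_natCast] at hik
  have : j ≤ i := by exact_mod_cast hle
  omega

/-- If `(X_m)` are `{0,1}`-valued with `P(X_m = 1) = h`, each `X_m`
independent of `σ(Y_m, X_1, …, X_{m-1})`, and `|Y_m| ≤ M` a.s., then
`N = inf{m ≥ 1 : X_m = 1}` is a.s. finite, `∑_{m=1}^N Y_m` is integrable, and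
`E[∑_{m=1}^N Y_m] = (1/h) · E[Y_N]`. -/
theorem geometric_stopping_sum {Ωs : Type*} [MeasurableSpace Ωs]
    (P : Measure Ωs) [IsProbabilityMeasure P]
    (h M : ℝ) (hh : h ∈ Set.Ioo (0 : ℝ) 1) (hM : 0 ≤ M)
    (X : ℕ → Ωs → Bool) (Y : ℕ → Ωs → ℝ)
    (hXmeas : ∀ m, Measurable (X m)) (hYmeas : ∀ m, Measurable (Y m))
    (hX : ∀ m, 1 ≤ m → P {ω | X m ω = true} = ENNReal.ofReal h)
    (hY : ∀ m, 1 ≤ m → ∀ᵐ ω ∂P, |Y m ω| ≤ M)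
    (hindep : ∀ m, 1 ≤ m →
      Indep (MeasurableSpace.comap (X m) ⊤)
        (MeasurableSpace.comap (Y m) Real.measurableSpace ⊔
          ⨆ i ∈ Set.Ico 1 m, MeasurableSpace.comap (X i) ⊤) P)
    (N : Ωs → ℕ∞)
    (hN : ∀ ω, N ω = sInf ((fun j : ℕ => (j : ℕ∞)) '' {j | 1 ≤ j ∧ X j ω = true})) :
    (∀ᵐ ω ∂P, N ω ≠ ⊤) ∧
      Integrable (fun ω => ∑ m ∈ Finset.Icc 1 (N ω).toNat, Y m ω) P ∧
      ∫ ω, (∑ m ∈ Finset.Icc 1 (N ω).toNat, Y m ω) ∂P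
        = (1 / h) * ∫ ω, Y (N ω).toNat ω ∂P := by
  obtain ⟨hh0, hh1⟩ := hh
  set A : ℕ → Set Ωs := fun m => {ω | ∀ i ∈ Set.Ico 1 m, X i ω = false} with hA
  set T : ℕ → Set Ωs := fun m => {ω | X m ω = true} with hT
  let 𝒢 : ℕ → MeasurableSpace Ωs := fun m =>
    MeasurableSpace.comap (Y m) Real.measurableSpace ⊔
      ⨆ i ∈ Set.Ico 1 m, MeasurableSpace.comap (X i) ⊤
  have h𝒢 (m) : 𝒢 m ≤ ‹MeasurableSpace Ωs› :=
    sup_le (hYmeas m).comap_le (iSup₂_le fun i _ => (hXmeas i).comap_le)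
  have hA𝒢 (m) : MeasurableSet[𝒢 m] (A m) := by
    have : A m = ⋂ i ∈ Set.Ico 1 m, X i ⁻¹' {false} := by ext; simp [hA]
    rw [this]
    refine MeasurableSet.biInter (Set.to_countable _) fun i hi => ?_
    have hle : MeasurableSpace.comap (X i) ⊤ ≤ 𝒢 m :=
      (le_iSup₂_of_le (f := fun i (_ : i ∈ Set.Ico 1 m) => MeasurableSpace.comap (X i) ⊤)
        i hi le_rfl).trans le_sup_right
    exact hle _ ⟨{false}, trivial, rfl⟩
  have hAm (m) : MeasurableSet (A m) := h𝒢 m _ (hA𝒢 m)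
  have hTm (m) : MeasurableSet (T m) := hXmeas m (measurableSet_singleton true)
  have hPT (m) (hm : 1 ≤ m) : P.real (T m) = h := by
    rw [measureReal_def, hX m hm, ENNReal.toReal_ofReal hh0.le]
  have hmul (m) (hm : 1 ≤ m) (g : Ωs → ℝ) (hg : Measurable[𝒢 m] g) :
      ∫ ω, (T m).indicator g ω ∂P = h * ∫ ω, g ω ∂P := by
    rw [← hPT m hm]
    exact integral_indicator_eq_measureReal_mul_of_indep (hindep m hm) (hXmeas m).comap_le (h𝒢 m)
      ⟨{true}, trivial, rfl⟩ hg
  have hPA (n : ℕ) : P.real (A (n + 1)) = (1 - h) ^ n := by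
    induction n with
    | zero =>
      have : A (0 + 1) = Set.univ :=
        Set.eq_univ_of_forall fun ω i hi => absurd hi.2 (by have := hi.1; omega)
      simp [this]
    | succ n ih =>
      have hsplit : A (n + 2) = A (n + 1) \ T (n + 1) := by
        ext ω
        simp only [hA, hT, Set.mem_Ico, Set.mem_ofPred_eq, Set.mem_sdiff, Bool.not_eq_true]
        refine ⟨fun hω => ⟨fun i hi => hω i (by omega), hω _ (by omega)⟩, fun hω i hi => ?_⟩
        rcases Nat.lt_or_ge i (n + 1) with hlt | hge
        · exact hω.1 i ⟨hi.1, hlt⟩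
        · obtain rfl : i = n + 1 := by omega
          exact hω.2
      have hinter := hmul (n + 1) (by omega) ((A (n + 1)).indicator 1)
        (Measurable.indicator (@measurable_const _ _ _ (𝒢 (n + 1)) (1 : ℝ)) (hA𝒢 _))
      rw [Set.indicator_indicator, integral_indicator_one ((hTm _).inter (hAm _)),
        integral_indicator_one (hAm _), ih, Set.inter_comm] at hinter
      have hdiff := measureReal_inter_add_sdiff (μ := P) (s := A (n + 1)) (hTm (n + 1))
      rw [hinter, ih, ← hsplit] at hdiff
      rw [show n + 1 + 1 = n + 2 from rfl, pow_succ]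
      linarith
  have hgeom : Summable fun n : ℕ => (1 - h) ^ n :=
    summable_geometric_of_lt_one (by linarith) (by linarith)
  have hfin : ∀ᵐ ω ∂P, N ω ≠ ⊤ := by
    have hzero : P.real {ω | N ω = ⊤} = 0 := by
      refine le_antisymm (ge_of_tendsto' hgeom.tendsto_atTop_zero fun n => ?_) measureReal_nonneg
      rw [← hPA n]
      refine measureReal_mono fun ω hω i hi => ?_
      by_contra hXi
      have hle : N ω ≤ i := hN ω ▸ sInf_le ⟨i, ⟨hi.1, by simpa using hXi⟩, rfl⟩
      rw [show N ω = ⊤ from hω] at hle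
      simp at hle
    rw [ae_iff]
    simpa using (measureReal_eq_zero_iff).mp hzero
  have hYint (m) (hm : 1 ≤ m) : Integrable (Y m) P :=
    .of_bound (hYmeas m).aestronglyMeasurable M (hY m hm)
  set F : ℕ → Ωs → ℝ := fun n => (A (n + 1)).indicator (Y (n + 1)) with hF
  set G : ℕ → Ωs → ℝ := fun n => (T (n + 1)).indicator (F n) with hG
  have hFint (n) : Integrable (F n) P := (hYint _ (by omega)).indicator (hAm _)
  have hGint (n) : Integrable (G n) P := (hFint n).indicator (hTm _)
  have hFsum : Summable fun n => ∫ ω, ‖F n ω‖ ∂P := by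
    refine .of_nonneg_of_le (fun n => integral_nonneg fun ω => norm_nonneg _) (fun n => ?_)
      (hgeom.mul_right M)
    calc ∫ ω, ‖F n ω‖ ∂P ≤ ∫ ω, (A (n + 1)).indicator (fun _ => M) ω ∂P := by
          refine integral_mono_ae (hFint n).norm ((integrable_const M).indicator (hAm _)) ?_
          filter_upwards [hY (n + 1) (by omega)] with ω hω
          simp only [hF, norm_indicator_eq_indicator_norm, Real.norm_eq_abs]
          exact Set.indicator_le_indicator hω
      _ = (1 - h) ^ n * M := by rw [integral_indicator_const _ (hAm _), hPA, smul_eq_mul]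
  have hGsum : Summable fun n => ∫ ω, ‖G n ω‖ ∂P := by
    refine .of_nonneg_of_le (fun n => integral_nonneg fun ω => norm_nonneg _) (fun n => ?_) hFsum
    exact integral_mono (hGint n).norm (hFint n).norm fun ω => norm_indicator_le_norm_self _ _
  have hmemA {ω} (hω : N ω ≠ ⊤) (m : ℕ) : ω ∈ A m ↔ m ≤ (N ω).toNat := by
    obtain ⟨h1, hX1, hlt⟩ := toNat_sInf_image_spec (hN ω) hω
    refine ⟨fun hm => ?_, fun hm i hi => ?_⟩
    · by_contra hlt'
      have := hm _ ⟨h1, by omega⟩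
      simp_all
    · simpa using hlt i hi.1 (hi.2.trans_le hm)
  obtain ⟨hSint, hShas⟩ := integrable_and_hasSum_integral_of_hasSum
    (S := fun ω => ∑ m ∈ Finset.Icc 1 (N ω).toNat, Y m ω) hFint hFsum <| by
      filter_upwards [hfin] with ω hω
      have hsum : ∑ m ∈ Finset.Icc 1 (N ω).toNat, Y m ω
          = ∑ n ∈ Finset.range (N ω).toNat, F n ω := by
        rw [← Finset.Ico_add_one_right_eq_Icc, Finset.sum_Ico_eq_sum_range]
        refine Finset.sum_congr (by simp) fun n hn => ?_
        rw [Finset.mem_range] at hn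
        rw [add_comm 1 n]
        exact (Set.indicator_of_mem ((hmemA hω _).mpr (by omega)) _).symm
      rw [hsum]
      refine hasSum_sum_of_ne_finset_zero fun n hn => ?_
      rw [Finset.mem_range] at hn
      exact Set.indicator_of_notMem (by rw [hmemA hω]; omega) _
  have hYhas := (integrable_and_hasSum_integral_of_hasSum
    (S := fun ω => Y (N ω).toNat ω) hGint hGsum <| by
      filter_upwards [hfin] with ω hω
      obtain ⟨h1, hX1, hlt⟩ := toNat_sInf_image_spec (hN ω) hω
      obtain ⟨k, hk⟩ : ∃ k, (N ω).toNat = k + 1 := ⟨(N ω).toNat - 1, by omega⟩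
      have hval : Y (N ω).toNat ω = G k ω := by
        simp only [hG, hF]
        rw [← hk, Set.indicator_of_mem (show ω ∈ T _ from hX1),
          Set.indicator_of_mem ((hmemA hω _).mpr le_rfl)]
      rw [hval]
      refine hasSum_single k fun n hn => ?_
      simp only [hG, hF]
      by_cases hmem : ω ∈ T (n + 1)
      · rw [Set.indicator_of_mem hmem, Set.indicator_of_notMem]
        rw [hmemA hω]
        intro hle
        exact hlt (n + 1) (by omega) (by omega) hmem
      · exact Set.indicator_of_notMem hmem _).2
  refine ⟨hfin, hSint, ?_⟩
  have hGF (n) : ∫ ω, G n ω ∂P = h * ∫ ω, F n ω ∂P := by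
    refine hmul (n + 1) (by omega) (F n) (Measurable.indicator ?_ (hA𝒢 _))
    exact (comap_measurable (Y (n + 1))).mono le_sup_left le_rfl
  simp only [hGF] at hYhas
  rw [hYhas.unique (hShas.mul_left h), one_div, inv_mul_cancel_left₀ hh0.ne']
end

section
/- Let (Ω, F, P) be a probability space, h ∈ (0,1), M ≥ 0, and let (X_m)_{m≥1} be {0,1}-valued random variables with P(X_m = 1) = h for every m, and (Y_m)_{m≥1} be real random variables with |Y_m| ≤ M almost surely. Assume that for each m ≥ 1, X_m is independent of the σ-algebra generated by (Y_m, X_1, …, X_{m−1}). Let N = inf{m ≥ 1 : X_m = 1}. Then for every m ≥ 1, E[1_{{N = m}} · Y_m] = h · E[1_{{N ≥ m}} · Y_m]. -/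
open MeasureTheory ProbabilityTheory

/-- A level `m` is at most the first success time iff there is no success before `m`. -/
lemma natCast_le_sInf_iff (p : ℕ → Prop) (m : ℕ) :
    (m : ℕ∞) ≤ sInf ((fun j : ℕ => (j : ℕ∞)) '' {j | 1 ≤ j ∧ p j}) ↔
      ∀ j ∈ Set.Ico 1 m, ¬ p j := by
  simp only [le_sInf_iff, Set.forall_mem_image, Set.mem_ofPred_eq, Nat.cast_le, Set.mem_Ico]
  exact ⟨fun H j hj hp => absurd (H ⟨hj.1, hp⟩) (by lia),
    fun H j hj => not_lt.1 fun hlt => H j ⟨hj.1, hlt⟩ hj.2⟩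

/-- The first success time equals `m` iff it is at least `m` and `m` is a success. -/
lemma sInf_eq_natCast_iff (p : ℕ → Prop) {m : ℕ} (hm : 1 ≤ m) :
    sInf ((fun j : ℕ => (j : ℕ∞)) '' {j | 1 ≤ j ∧ p j}) = (m : ℕ∞) ↔
      (m : ℕ∞) ≤ sInf ((fun j : ℕ => (j : ℕ∞)) '' {j | 1 ≤ j ∧ p j}) ∧ p m := by
  refine ⟨fun H => ⟨H.ge, ?_⟩, fun H => le_antisymm (sInf_le ⟨m, ⟨hm, H.2⟩, rfl⟩) H.1⟩
  by_contra hp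
  have hlt : ((m + 1 : ℕ) : ℕ∞) ≤ (m : ℕ∞) := by
    rw [← H, natCast_le_sInf_iff]
    intro j hj hpj
    rcases (Nat.lt_succ_iff.1 hj.2).eq_or_lt with rfl | hjm
    · exact hp hpj
    · exact (natCast_le_sInf_iff p m).1 H.ge j ⟨hj.1, hjm⟩ hpj
  exact absurd (Nat.cast_le.1 hlt) (by lia)

/-- If `(X_m)` are `{0,1}`-valued with `P(X_m = 1) = h`, each `X_m`
independent of `σ(Y_m, X_1, …, X_{m-1})`, `|Y_m| ≤ M` a.s., and
`N = inf{m ≥ 1 : X_m = 1}`, then for every `m ≥ 1`,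
`E[1_{N = m} · Y_m] = h · E[1_{N ≥ m} · Y_m]`. -/
theorem stopping_slice_expectation {Ωs : Type*} [MeasurableSpace Ωs]
    (P : Measure Ωs) [IsProbabilityMeasure P]
    (h M : ℝ) (hh : h ∈ Set.Ioo (0 : ℝ) 1) (hM : 0 ≤ M)
    (X : ℕ → Ωs → Bool) (Y : ℕ → Ωs → ℝ)
    (hXmeas : ∀ m, Measurable (X m)) (hYmeas : ∀ m, Measurable (Y m))
    (hX : ∀ m, 1 ≤ m → P {ω | X m ω = true} = ENNReal.ofReal h)
    (hY : ∀ m, 1 ≤ m → ∀ᵐ ω ∂P, |Y m ω| ≤ M)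
    (hindep : ∀ m, 1 ≤ m →
      Indep (MeasurableSpace.comap (X m) ⊤)
        (MeasurableSpace.comap (Y m) Real.measurableSpace ⊔
          ⨆ i ∈ Set.Ico 1 m, MeasurableSpace.comap (X i) ⊤) P)
    (N : Ωs → ℕ∞)
    (hN : ∀ ω, N ω = sInf ((fun j : ℕ => (j : ℕ∞)) '' {j | 1 ≤ j ∧ X j ω = true})) :
    ∀ m : ℕ, 1 ≤ m →
      ∫ ω, (if N ω = (m : ℕ∞) then Y m ω else 0) ∂P
        = h * ∫ ω, (if (m : ℕ∞) ≤ N ω then Y m ω else 0) ∂P := by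
  intro m hm
  set f : Ωs → ℝ := fun ω => if X m ω = true then 1 else 0 with hf
  set g : Ωs → ℝ := fun ω => if (m : ℕ∞) ≤ N ω then Y m ω else 0 with hg
  have h𝓖le : MeasurableSpace.comap (Y m) Real.measurableSpace ⊔
      ⨆ i ∈ Set.Ico 1 m, MeasurableSpace.comap (X i) ⊤ ≤ ‹MeasurableSpace Ωs› :=
    sup_le (hYmeas m).comap_le (iSup₂_le fun i _ => (hXmeas i).comap_le)
  have hXset : MeasurableSet {ω | X m ω = true} :=
    hXmeas m (MeasurableSet.of_discrete (s := {true}))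
  have hfmeas : Measurable f := Measurable.ite hXset measurable_const measurable_const
  have hintf : ∫ ω, f ω ∂P = h := by
    have hind : f = {ω | X m ω = true}.indicator 1 := by
      funext ω
      simp [hf, Set.indicator_apply]
    rw [hind, integral_indicator_one hXset, measureReal_def, hX m hm,
      ENNReal.toReal_ofReal hh.1.le]
  have hgmeas : Measurable g → AEStronglyMeasurable g P := fun H => H.aestronglyMeasurable
  set 𝓖 : MeasurableSpace Ωs := MeasurableSpace.comap (Y m) Real.measurableSpace ⊔
    ⨆ i ∈ Set.Ico 1 m, MeasurableSpace.comap (X i) ⊤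
  have hY𝓖 : Measurable[𝓖] (Y m) := Measurable.of_comap_le le_sup_left
  have hX𝓖 : ∀ i ∈ Set.Ico 1 m, Measurable[𝓖] (X i) := fun i hi =>
    Measurable.of_comap_le
      ((le_iSup₂ (f := fun i (_ : i ∈ Set.Ico 1 m) => MeasurableSpace.comap (X i) ⊤) i hi).trans
        le_sup_right)
  have hset : MeasurableSet[𝓖] {ω | (m : ℕ∞) ≤ N ω} := by
    have heq : {ω | (m : ℕ∞) ≤ N ω} = ⋂ i ∈ Set.Ico 1 m, X i ⁻¹' {true}ᶜ := by
      ext ω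
      simp only [Set.mem_ofPred_eq, hN, natCast_le_sInf_iff (fun j => X j ω = true)]
      simp
    rw [heq]
    exact MeasurableSet.biInter (Set.to_countable _)
      fun i hi => hX𝓖 i hi (MeasurableSet.of_discrete)
  have hg𝓖 : Measurable[𝓖] g :=
    Measurable.ite hset hY𝓖 measurable_const
  have hfcomap : Measurable[MeasurableSpace.comap (X m) ⊤] f :=
    (measurable_of_countable fun b : Bool => if b = true then (1 : ℝ) else 0).comp
      (comap_measurable (X m))
  have hfg : IndepFun f g P := (IndepFun_iff_Indep f g P).2 <|
    indep_of_indep_of_le_left (indep_of_indep_of_le_right (hindep m hm) hg𝓖.comap_le)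
      hfcomap.comap_le
  have hprod : (fun ω => if N ω = (m : ℕ∞) then Y m ω else 0) = fun ω => f ω * g ω := by
    funext ω
    have hiff : N ω = (m : ℕ∞) ↔ (m : ℕ∞) ≤ N ω ∧ X m ω = true := by
      rw [hN]
      exact sInf_eq_natCast_iff (fun j => X j ω = true) hm
    by_cases h1 : X m ω = true <;> simp [hf, hg, hiff, h1]
  rw [hprod, hfg.integral_fun_mul_eq_mul_integral hfmeas.aestronglyMeasurable
    (hgmeas (hg𝓖.mono h𝓖le le_rfl)), hintf]
end

section
/- Let (Ω, F, P) be a probability space, h ∈ (0,1), and M ≥ 0. Let (Y_j)_{j≥1} be real random variables with |Y_j| ≤ M almost surely, and let (T_k)_{k≥1} be positive-integer-valued random variables with E[T_k] = k/h and Var(T_k) = (1−h)k/h² for every k ≥ 1. Set t_k = ⌊k/h⌋. Then liminf_{k→∞} E[(1/t_k) Σ_{j=1}^{t_k} Y_j] = liminf_{k→∞} E[(h/k) Σ_{j=1}^{T_k} Y_j]. -/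
open MeasureTheory ProbabilityTheory Filter

/-- If `u - v → 0` and both are eventually bounded, then `liminf u ≤ liminf v`. -/
theorem liminf_le_liminf_of_tendsto_sub {u v : ℕ → ℝ} {C : ℝ}
    (hu : ∀ᶠ k in atTop, |u k| ≤ C) (hv : ∀ᶠ k in atTop, |v k| ≤ C)
    (huv : Tendsto (fun k => u k - v k) atTop (nhds 0)) :
    liminf u atTop ≤ liminf v atTop := by
  refine le_of_forall_lt fun c hc => ?_
  obtain ⟨d, hcd, hd⟩ := exists_between hc
  have hbu : IsBoundedUnder (· ≥ ·) atTop u :=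
    isBoundedUnder_of_eventually_ge (hu.mono fun k hk => (abs_le.1 hk).1)
  have hcv : IsCoboundedUnder (· ≥ ·) atTop v :=
    IsBoundedUnder.isCoboundedUnder_ge
      (isBoundedUnder_of_eventually_le (hv.mono fun k hk => (abs_le.1 hk).2))
  have hlt : (c + d) / 2 ≤ liminf v atTop := by
    refine le_liminf_of_le hcv ?_
    filter_upwards [eventually_lt_of_lt_liminf hd hbu,
      huv.eventually_lt_const (show (0 : ℝ) < (d - c) / 2 by linarith)] with k h1 h2
    linarith
  linarith

/-- Two sequences with difference tending to `0`, one of them bounded, have equal `liminf`. -/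
theorem liminf_eq_liminf_of_tendsto_sub {u v : ℕ → ℝ} {C : ℝ} (hu : ∀ k, |u k| ≤ C)
    (huv : Tendsto (fun k => u k - v k) atTop (nhds 0)) :
    liminf u atTop = liminf v atTop := by
  have hv : ∀ᶠ k in atTop, |v k| ≤ C + 1 := by
    filter_upwards [huv.abs.eventually_lt_const (show |(0 : ℝ)| < 1 by simp)] with k hk
    have := abs_sub_abs_le_abs_sub (v k) (u k)
    rw [abs_sub_comm] at this
    linarith [hu k]
  have hu' : ∀ᶠ k in atTop, |u k| ≤ C + 1 := .of_forall fun k => (hu k).trans (by linarith)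
  exact le_antisymm (liminf_le_liminf_of_tendsto_sub hu' hv huv)
    (liminf_le_liminf_of_tendsto_sub hv hu' (by simpa using huv.neg))

/-- Partial sums of a sequence bounded by `M` are `M`-Lipschitz in the number of terms. -/
theorem abs_sum_Icc_sub_sum_Icc_le {y : ℕ → ℝ} {M : ℝ} (hy : ∀ j, 1 ≤ j → |y j| ≤ M) (a b : ℕ) :
    |∑ j ∈ Finset.Icc 1 a, y j - ∑ j ∈ Finset.Icc 1 b, y j| ≤ M * |(a : ℝ) - b| := by
  wlog hab : b ≤ a generalizing a b
  · rw [abs_sub_comm, abs_sub_comm (a : ℝ)]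
    exact this b a (by omega)
  induction a, hab using Nat.le_induction with
  | base => simp
  | succ n hn ih =>
    have hn' : (b : ℝ) ≤ n := by exact_mod_cast hn
    rw [abs_of_nonneg (sub_nonneg.2 hn')] at ih
    rw [Finset.sum_Icc_succ_top (by omega), Nat.cast_succ,
      abs_of_nonneg (show (0 : ℝ) ≤ n + 1 - b by linarith)]
    have h1 := hy (n + 1) (by omega)
    rw [add_sub_right_comm]
    refine (abs_add_le _ _).trans ?_
    linarith

theorem abs_sum_Icc_le {y : ℕ → ℝ} {M : ℝ} (hy : ∀ j, 1 ≤ j → |y j| ≤ M) (a : ℕ) :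
    |∑ j ∈ Finset.Icc 1 a, y j| ≤ M * a := by
  simpa using abs_sum_Icc_sub_sum_Icc_le hy a 0

/-- A sum of measurable functions up to a measurable random index is measurable. -/
theorem measurable_sum_Icc_random {Ωs : Type*} [MeasurableSpace Ωs] {Y : ℕ → Ωs → ℝ}
    {N : Ωs → ℕ} (hY : ∀ j, Measurable (Y j)) (hN : Measurable N) :
    Measurable fun ω => ∑ j ∈ Finset.Icc 1 (N ω), Y j ω := by
  have h : Measurable fun p : ℕ × Ωs => ∑ j ∈ Finset.Icc 1 p.1, Y j p.2 :=
    measurable_from_prod_countable_right fun n =>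
      Finset.measurable_fun_sum (Finset.Icc 1 n) fun j _ => hY j
  exact h.comp (hN.prodMk measurable_id)

/-- Mean absolute deviation is controlled by the variance, at any scale `s > 0`. -/
theorem integral_abs_sub_integral_le {Ωs : Type*} [MeasurableSpace Ωs] {P : Measure Ωs}
    [IsProbabilityMeasure P] {X : Ωs → ℝ} (hX : MemLp X 2 P) {s : ℝ} (hs : 0 < s) :
    ∫ ω, |X ω - ∫ x, X x ∂P| ∂P ≤ (variance X P / s + s) / 2 := by
  have hD : MemLp (fun ω => X ω - ∫ x, X x ∂P) 2 P := hX.sub (memLp_const _)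
  have hsq : Integrable (fun ω => (X ω - ∫ x, X x ∂P) ^ 2) P := hD.integrable_sq
  rw [variance_eq_integral hX.aestronglyMeasurable.aemeasurable]
  calc ∫ ω, |X ω - ∫ x, X x ∂P| ∂P
      ≤ ∫ ω, ((X ω - ∫ x, X x ∂P) ^ 2 / s + s) / 2 ∂P := by
        refine integral_mono (hD.integrable (by norm_num)).abs
          (((hsq.div_const s).add (integrable_const s)).div_const 2) fun ω => ?_
        rw [le_div_iff₀ two_pos, div_add' _ _ _ hs.ne', le_div_iff₀ hs, ← sq_abs]
        nlinarith [sq_nonneg (|X ω - ∫ x, X x ∂P| - s)]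
    _ = _ := by
        rw [integral_div, integral_add (hsq.div_const s) (integrable_const s), integral_div]
        simp

theorem memLp_two_of_variance_pos {Ωs : Type*} [MeasurableSpace Ωs] {P : Measure Ωs}
    [IsFiniteMeasure P] {X : Ωs → ℝ} (hX : AEStronglyMeasurable X P) (hv : 0 < variance X P) :
    MemLp X 2 P := by
  by_contra hn
  rw [variance, evariance_eq_top hX hn] at hv
  simp at hv

/-- If `|Y_j| ≤ M` a.s., and `(T_k)` are positive-integer-valued
with `E[T_k] = k/h` and `Var(T_k) = (1-h)k/h²`, then, with `t_k = ⌊k/h⌋`,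
`liminf_k E[(1/t_k) ∑_{j=1}^{t_k} Y_j] = liminf_k E[(h/k) ∑_{j=1}^{T_k} Y_j]`. -/
theorem liminf_random_time_average {Ωs : Type*} [MeasurableSpace Ωs]
    (P : Measure Ωs) [IsProbabilityMeasure P]
    (h M : ℝ) (hh : h ∈ Set.Ioo (0 : ℝ) 1) (hM : 0 ≤ M)
    (Y : ℕ → Ωs → ℝ) (T : ℕ → Ωs → ℕ)
    (hYmeas : ∀ j, Measurable (Y j)) (hTmeas : ∀ k, Measurable (T k))
    (hY : ∀ j, 1 ≤ j → ∀ᵐ ω ∂P, |Y j ω| ≤ M)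
    (hTpos : ∀ k, 1 ≤ k → ∀ ω, 1 ≤ T k ω)
    (hTint : ∀ k, 1 ≤ k → Integrable (fun ω => (T k ω : ℝ)) P)
    (hTmean : ∀ k : ℕ, 1 ≤ k → ∫ ω, (T k ω : ℝ) ∂P = k / h)
    (hTvar : ∀ k : ℕ, 1 ≤ k →
      variance (fun ω => (T k ω : ℝ)) P = (1 - h) * k / h ^ 2) :
    liminf (fun k : ℕ =>
        ∫ ω, (1 / (⌊(k : ℝ) / h⌋₊ : ℝ)) * ∑ j ∈ Finset.Icc 1 ⌊(k : ℝ) / h⌋₊, Y j ω ∂P)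
        atTop
      = liminf (fun k : ℕ =>
          ∫ ω, (h / (k : ℝ)) * ∑ j ∈ Finset.Icc 1 (T k ω), Y j ω ∂P) atTop := by
  obtain ⟨hh0, hh1⟩ := hh
  have hYall : ∀ᵐ ω ∂P, ∀ j, 1 ≤ j → |Y j ω| ≤ M := by
    simpa only [ae_all_iff] using hY
  refine liminf_eq_liminf_of_tendsto_sub (C := M) (fun k => ?_) ?_
  · rw [← Real.norm_eq_abs]
    refine (norm_integral_le_of_norm_le_const (C := M) ?_).trans_eq
      (by rw [probReal_univ, mul_one])
    filter_upwards [hYall] with ω hω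
    rw [Real.norm_eq_abs, abs_mul, abs_of_nonneg (by positivity), one_div_mul_eq_div]
    exact div_le_of_le_mul₀ (by positivity) hM (abs_sum_Icc_le hω _)
  set D : ℝ := ((1 - h) / h ^ 2 + 1) / 2
  refine squeeze_zero_norm' (a := fun k : ℕ => 2 * M * h * (k : ℝ)⁻¹ + M * h * D * (√(k : ℝ))⁻¹)
    ?_ ?_
  · filter_upwards [eventually_ge_atTop 1] with k hk
    have hk0 : (0 : ℝ) < k := by exact_mod_cast hk
    have hk1 : (1 : ℝ) ≤ k := by exact_mod_cast hk
    set t := ⌊(k : ℝ) / h⌋₊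
    have ht1 : (t : ℝ) ≤ k / h := Nat.floor_le (by positivity)
    have ht2 : (k : ℝ) / h < t + 1 := Nat.lt_floor_add_one _
    have htpos : (0 : ℝ) < t := by
      have : 1 ≤ t := Nat.le_floor (by
        rw [Nat.cast_one, le_div_iff₀ hh0]; linarith)
      exact_mod_cast this
    have hL2 : MemLp (fun ω => (T k ω : ℝ)) 2 P := by
      refine memLp_two_of_variance_pos (hTint k hk).aestronglyMeasurable ?_
      rw [hTvar k hk]
      have : 0 < 1 - h := by linarith
      positivity
    have hdev := integral_abs_sub_integral_le hL2 (Real.sqrt_pos.2 hk0)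
    rw [hTvar k hk, hTmean k hk] at hdev
    have hdev' : ∫ ω, |(T k ω : ℝ) - k / h| ∂P ≤ D * √(k : ℝ) := by
      refine hdev.trans_eq ?_
      have : (1 - h) * k / h ^ 2 / √(k : ℝ) = (1 - h) / h ^ 2 * √(k : ℝ) := by
        rw [div_eq_iff (Real.sqrt_pos.2 hk0).ne', mul_assoc, Real.mul_self_sqrt hk0.le]
        ring
      rw [this]
      ring
    have hint1 : Integrable (fun ω => (1 / (t : ℝ)) * ∑ j ∈ Finset.Icc 1 t, Y j ω) P := by
      refine Integrable.const_mul (integrable_finsetSum _ fun j hj => ?_) _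
      exact Integrable.of_bound (hYmeas j).aestronglyMeasurable M
        (hY j (Finset.mem_Icc.1 hj).1)
    have hint2 : Integrable (fun ω => (h / (k : ℝ)) * ∑ j ∈ Finset.Icc 1 (T k ω), Y j ω) P := by
      refine Integrable.const_mul ?_ _
      refine ((hTint k hk).const_mul M).mono'
        (measurable_sum_Icc_random hYmeas (hTmeas k)).aestronglyMeasurable ?_
      filter_upwards [hYall] with ω hω using abs_sum_Icc_le hω _
    have hDint : Integrable (fun ω => |(T k ω : ℝ) - k / h|) P :=
      ((hTint k hk).sub (integrable_const _)).abs
    rw [← integral_sub hint1 hint2]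
    have hbound : ∀ᵐ ω ∂P, ‖(1 / (t : ℝ)) * ∑ j ∈ Finset.Icc 1 t, Y j ω
        - (h / (k : ℝ)) * ∑ j ∈ Finset.Icc 1 (T k ω), Y j ω‖
        ≤ 2 * M * h * (k : ℝ)⁻¹ + M * h * (k : ℝ)⁻¹ * |(T k ω : ℝ) - k / h| := by
      filter_upwards [hYall] with ω hω
      set S := ∑ j ∈ Finset.Icc 1 t, Y j ω
      set R := ∑ j ∈ Finset.Icc 1 (T k ω), Y j ω
      have hS : |S| ≤ M * t := abs_sum_Icc_le hω t
      have hSR : |S - R| ≤ M * |(t : ℝ) - T k ω| := abs_sum_Icc_sub_sum_Icc_le hω t (T k ω)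
      have htT : |(t : ℝ) - T k ω| ≤ 1 + |(T k ω : ℝ) - k / h| := by
        rw [abs_sub_comm]
        refine (abs_sub_le _ ((k : ℝ) / h) _).trans ?_
        rw [abs_of_nonneg (sub_nonneg.2 ht1)]
        linarith
      have hcoef : 0 ≤ 1 / (t : ℝ) - h / k := by
        rw [sub_nonneg, div_le_div_iff₀ hk0 htpos]
        rw [le_div_iff₀ hh0] at ht1
        linarith
      have hcoef' : (1 / (t : ℝ) - h / k) * t ≤ h * (k : ℝ)⁻¹ := by
        have e : (1 / (t : ℝ) - h / k) * t = (k / h - t) * (h * (k : ℝ)⁻¹) := by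
          field_simp
        rw [e]
        exact mul_le_of_le_one_left (by positivity) (by linarith)
      have hdecomp : 1 / (t : ℝ) * S - h / k * R = (1 / (t : ℝ) - h / k) * S + h / k * (S - R) := by
        ring
      rw [Real.norm_eq_abs, hdecomp]
      calc |(1 / (t : ℝ) - h / k) * S + h / k * (S - R)|
          ≤ (1 / (t : ℝ) - h / k) * |S| + h / k * |S - R| := by
            refine (abs_add_le _ _).trans_eq ?_
            rw [abs_mul, abs_mul, abs_of_nonneg hcoef,
              abs_of_nonneg (show 0 ≤ h / (k : ℝ) by positivity)]
        _ ≤ (1 / (t : ℝ) - h / k) * (M * t) + h / k * (M * (1 + |(T k ω : ℝ) - k / h|)) := by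
            gcongr
            exact hSR.trans (by gcongr)
        _ = M * ((1 / (t : ℝ) - h / k) * t) + h / k * (M * (1 + |(T k ω : ℝ) - k / h|)) := by ring
        _ ≤ M * (h * (k : ℝ)⁻¹) + h / k * (M * (1 + |(T k ω : ℝ) - k / h|)) := by gcongr
        _ = _ := by ring
    refine (norm_integral_le_of_norm_le
      ((integrable_const _).add (hDint.const_mul _)) hbound).trans ?_
    rw [integral_add' (integrable_const _) (hDint.const_mul _), integral_const,
      integral_const_mul, probReal_univ, one_smul]
    refine add_le_add_right ((mul_le_mul_of_nonneg_left hdev' (by positivity)).trans_eq ?_) _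
    have : (k : ℝ)⁻¹ * √(k : ℝ) = (√(k : ℝ))⁻¹ := by
      rw [inv_mul_eq_div, Real.sqrt_div_self]
    rw [← this]
    ring
  · have h1 : Tendsto (fun k : ℕ => (k : ℝ)⁻¹) atTop (nhds 0) := tendsto_inv_atTop_nhds_zero_nat
    have h2 : Tendsto (fun k : ℕ => (√(k : ℝ))⁻¹) atTop (nhds 0) :=
      (Real.tendsto_sqrt_atTop.comp tendsto_natCast_atTop_atTop).inv_tendsto_atTop
    simpa using (h1.const_mul (2 * M * h)).add (h2.const_mul (M * h * D))
end
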